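/- arXiv:solv-int/9710022 — 9 statements merged into one kernel-verified Lean document; each statement's English description precedes it below -/
import Mathlib

section
/- Let ε ∈ ℂ with ε ≠ 0, set α := 4/ε¹⁵, let U ⊆ ℂ be open, and let Y : ℂ → ℂ be twice differentiable on U. Define y(x) := ε·Y(X) + ε⁻⁵ where X := (x + 6·ε⁻¹⁰)/ε². Then for every x ∈ ℂ with X ∈ U, the equation y″(x) = 2·y(x)³ + x·y(x) + α holds at x if and only if Y″(X) = 6·Y(X)² + X + ε⁶·(2·Y(X)³ + X·Y(X)). -/
/-- Derivative of a function precomposed with an affine map; no differentiability is needed. -/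
theorem deriv_comp_add_const_div (f : ℂ → ℂ) (c d : ℂ) :
    deriv (fun x => f ((x + c) / d)) = fun x => d⁻¹ * deriv f ((x + c) / d) := by
  funext x
  rw [deriv_comp_add_const (fun z => f (z / d)) c x]
  simp only [div_eq_inv_mul]
  rw [deriv_comp_mul_left d⁻¹ f (x + c), smul_eq_mul]

/-- Under the substitution `x ↦ ε²X − 6/ε¹⁰`, `y = εY + 1/ε⁵`,
`α = 4/ε¹⁵`, the second Painlevé equation `y″ = 2y³ + xy + α` holds at `x`
iff `Y″(X) = 6Y(X)² + X + ε⁶(2Y(X)³ + X·Y(X))` where `X = (x + 6ε⁻¹⁰)/ε²`. -/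
theorem painleveII_to_painleveI_limit
    (ε : ℂ) (hε : ε ≠ 0) (α : ℂ) (hα : α = 4 / ε ^ 15)
    (U : Set ℂ) (hU : IsOpen U) (Y : ℂ → ℂ)
    (hY : ∀ X ∈ U, DifferentiableAt ℂ Y X ∧ DifferentiableAt ℂ (deriv Y) X)
    (y : ℂ → ℂ)
    (hy : ∀ x : ℂ, y x = ε * Y ((x + 6 * (ε ^ 10)⁻¹) / ε ^ 2) + (ε ^ 5)⁻¹) :
    ∀ x X : ℂ, X = (x + 6 * (ε ^ 10)⁻¹) / ε ^ 2 → X ∈ U →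
      (deriv (deriv y) x = 2 * y x ^ 3 + x * y x + α ↔
       deriv (deriv Y) X = 6 * Y X ^ 2 + X + ε ^ 6 * (2 * Y X ^ 3 + X * Y X)) := by
  intro x X hX _
  have hyd : deriv y =
      fun x => ε * ((ε ^ 2)⁻¹ * deriv Y ((x + 6 * (ε ^ 10)⁻¹) / ε ^ 2)) := by
    rw [funext hy]
    funext x
    rw [deriv_add_const, deriv_const_mul_field, deriv_comp_add_const_div]
  have hydd : deriv (deriv y) x = (ε ^ 3)⁻¹ * deriv (deriv Y) X := by
    rw [hyd, deriv_const_mul_field, deriv_const_mul_field, deriv_comp_add_const_div]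
    simp only [← hX]
    field_simp
  have hx : x = ε ^ 2 * X - 6 * (ε ^ 10)⁻¹ := by
    rw [hX]
    field_simp
    ring
  have hrhs : 2 * y x ^ 3 + x * y x + α =
      (ε ^ 3)⁻¹ * (6 * Y X ^ 2 + X + ε ^ 6 * (2 * Y X ^ 3 + X * Y X)) := by
    rw [hy x, ← hX, hα, hx]
    field_simp
    ring
  rw [hydd, hrhs]
  exact mul_right_inj' (inv_ne_zero (pow_ne_zero 3 hε))
end

section
/- Let ε ∈ ℝ with 0 < ε < 1, L := log(1/ε) with L ≥ 1, B > 0 real, κ := 6 + 2πB, and α ∈ ℂ with |α| ≥ 1/ε. Let U ⊆ ℂ be open, let w be analytic on U with w″(z) = 2·w(z)³ + 1 + (z/α)·w(z) on U, and let γ : [0,1] → U be a C¹ path of length at most 2πB such that for all t ∈ [0,1]: |γ(t)| ≤ 3ε·|α| and |w(γ(t))| ≤ L. Define E ∈ ℂ by 2E := w′(γ(0))² − w(γ(0))⁴ − 2·w(γ(0)). Then |w′(γ(1))² − (w(γ(1))⁴ + 2·w(γ(1)) + 2E)| ≤ κ·ε·L². -/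
open Set

/-- Along a solution of `w″ = 2w³ + 1 + (z/α)w`, the energy corrected by the integrated-by-parts
term `(z/α)w²` has derivative `-w²/α`. -/
lemma hasDerivAt_painleveII_correctedEnergy {w : ℂ → ℂ} {α z : ℂ} (hw : AnalyticAt ℂ w z)
    (hweq : deriv (deriv w) z = 2 * w z ^ 3 + 1 + (z / α) * w z) :
    HasDerivAt (fun x => deriv w x ^ 2 - w x ^ 4 - 2 * w x - x / α * w x ^ 2)
      (-(w z ^ 2 / α)) z := by
  have h1 := hw.differentiableAt.hasDerivAt
  have h2 := hw.deriv.differentiableAt.hasDerivAt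
  rw [hweq] at h2
  have h := (((h2.pow 2).sub (h1.pow 4)).sub (h1.const_mul 2)).sub
    (((hasDerivAt_id z).div_const α).mul (h1.pow 2))
  refine h.congr_deriv ?_
  simp only [Pi.pow_apply, id]
  push_cast
  ring

/-- If `G` has complex derivative `g` along a `C¹` path and `‖g‖ ≤ C` there, then `G` changes by at
most `C` times the length of the path. -/
lemma norm_sub_le_mul_length_of_hasDerivAt {G g : ℂ → ℂ} {γ γ' : ℝ → ℂ} {C : ℝ}
    (hγd : ∀ t ∈ Icc (0 : ℝ) 1, HasDerivWithinAt γ (γ' t) (Icc (0 : ℝ) 1) t)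
    (hγ'c : ContinuousOn γ' (Icc (0 : ℝ) 1))
    (hG : ∀ t ∈ Icc (0 : ℝ) 1, HasDerivAt G (g (γ t)) (γ t))
    (hgc : ContinuousOn (fun t => g (γ t)) (Icc (0 : ℝ) 1))
    (hgC : ∀ t ∈ Icc (0 : ℝ) 1, ‖g (γ t)‖ ≤ C) :
    ‖G (γ 1) - G (γ 0)‖ ≤ C * ∫ t in (0 : ℝ)..1, ‖γ' t‖ := by
  have hd : ∀ t ∈ Icc (0 : ℝ) 1,
      HasDerivWithinAt (fun s => G (γ s)) (g (γ t) * γ' t) (Icc (0 : ℝ) 1) t :=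
    fun t ht => (hG t ht).comp_hasDerivWithinAt t (hγd t ht)
  have hint : IntervalIntegrable (fun t => g (γ t) * γ' t) MeasureTheory.volume 0 1 :=
    (hgc.mul hγ'c).intervalIntegrable_of_Icc zero_le_one
  rw [← intervalIntegral.integral_eq_sub_of_hasDerivAt_of_le (f := fun s => G (γ s)) zero_le_one
    (fun t ht => (hd t ht).continuousWithinAt)
    (fun t ht => (hd t (Ioo_subset_Icc_self ht)).hasDerivAt (Icc_mem_nhds ht.1 ht.2)) hint,
    ← intervalIntegral.integral_const_mul]
  refine intervalIntegral.norm_integral_le_of_norm_le zero_le_one (.of_forall fun t ht => ?_)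
    ((hγ'c.norm.intervalIntegrable_of_Icc zero_le_one).const_mul C)
  rw [norm_mul]
  exact mul_le_mul_of_nonneg_right (hgC t (Ioc_subset_Icc_self ht)) (norm_nonneg _)

/-- First estimate of Theorem 2.1: for a generic solution of the
scaled second Painlevé equation `w″ = 2w³ + 1 + (z/α)w` in the region
`|z| ≤ 3ε|α|`, along a C¹ path of length at most `2πB` on which `|w| ≤ L`,
the energy deviation satisfies `|w′² − (w⁴ + 2w + 2E)| ≤ κεL²` where
`κ = 6 + 2πB` and `2E = w′(γ(0))² − w(γ(0))⁴ − 2w(γ(0))`. -/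
theorem painleveII_generic_first_estimate
    (ε L B κ : ℝ) (hε0 : 0 < ε) (hε1 : ε < 1)
    (hL : L = Real.log (1 / ε)) (hL1 : 1 ≤ L)
    (hB : 0 < B) (hκ : κ = 6 + 2 * Real.pi * B)
    (α : ℂ) (hα : 1 / ε ≤ ‖α‖)
    (U : Set ℂ) (hU : IsOpen U)
    (w : ℂ → ℂ) (hw : ∀ z ∈ U, AnalyticAt ℂ w z)
    (hweq : ∀ z ∈ U, deriv (deriv w) z = 2 * w z ^ 3 + 1 + (z / α) * w z)
    (γ γ' : ℝ → ℂ)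
    (hγU : ∀ t ∈ Icc (0 : ℝ) 1, γ t ∈ U)
    (hγd : ∀ t ∈ Icc (0 : ℝ) 1, HasDerivWithinAt γ (γ' t) (Icc (0 : ℝ) 1) t)
    (hγ'c : ContinuousOn γ' (Icc (0 : ℝ) 1))
    (hlen : (∫ t in (0 : ℝ)..1, ‖γ' t‖) ≤ 2 * Real.pi * B)
    (hγb : ∀ t ∈ Icc (0 : ℝ) 1, ‖γ t‖ ≤ 3 * ε * ‖α‖)
    (hwb : ∀ t ∈ Icc (0 : ℝ) 1, ‖w (γ t)‖ ≤ L)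
    (E : ℂ) (hE : 2 * E = deriv w (γ 0) ^ 2 - w (γ 0) ^ 4 - 2 * w (γ 0)) :
    ‖deriv w (γ 1) ^ 2 - (w (γ 1) ^ 4 + 2 * w (γ 1) + 2 * E)‖ ≤ κ * ε * L ^ 2 := by
  have hα0 : 0 < ‖α‖ := (one_div_pos.mpr hε0).trans_le hα
  have hαε : ‖α‖⁻¹ ≤ ε := inv_le_of_inv_le₀ hε0 (by simpa using hα)
  have hsq : ∀ t ∈ Icc (0 : ℝ) 1, ‖w (γ t)‖ ^ 2 ≤ L ^ 2 := fun t ht =>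
    pow_le_pow_left₀ (norm_nonneg _) (hwb t ht) 2
  have hvar := norm_sub_le_mul_length_of_hasDerivAt (g := fun z => -(w z ^ 2 / α))
    (C := ε * L ^ 2) hγd hγ'c
    (fun t ht => hasDerivAt_painleveII_correctedEnergy (hw _ (hγU t ht)) (hweq _ (hγU t ht)))
    (fun t ht => ((((hw _ (hγU t ht)).continuousAt.comp_continuousWithinAt
      (hγd t ht).continuousWithinAt).pow 2).div_const α).neg)
    (fun t ht => by
      rw [norm_neg, norm_div, norm_pow, div_eq_inv_mul]
      exact mul_le_mul hαε (hsq t ht) (by positivity) hε0.le)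
  have hvar' := hvar.trans (mul_le_mul_of_nonneg_left hlen (by positivity))
  have hbdry : ∀ t ∈ Icc (0 : ℝ) 1, ‖γ t / α * w (γ t) ^ 2‖ ≤ 3 * ε * L ^ 2 := fun t ht => by
    rw [norm_mul, norm_div, norm_pow]
    exact mul_le_mul ((div_le_iff₀ hα0).mpr (hγb t ht)) (hsq t ht) (by positivity) (by positivity)
  have h0 := hbdry 0 (by simp)
  have h1 := hbdry 1 (by simp)
  rw [hE]
  calc _ = ‖((deriv w (γ 1) ^ 2 - w (γ 1) ^ 4 - 2 * w (γ 1) - γ 1 / α * w (γ 1) ^ 2)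
          - (deriv w (γ 0) ^ 2 - w (γ 0) ^ 4 - 2 * w (γ 0) - γ 0 / α * w (γ 0) ^ 2))
          + γ 1 / α * w (γ 1) ^ 2 - γ 0 / α * w (γ 0) ^ 2‖ := by congr 1; ring
    _ ≤ ε * L ^ 2 * (2 * Real.pi * B) + 3 * ε * L ^ 2 + 3 * ε * L ^ 2 :=
        norm_sub_le_of_le (norm_add_le_of_le hvar' h1) h0
    _ = κ * ε * L ^ 2 := by rw [hκ]; ring
end

section
/- Let ε ∈ ℝ with 0 < ε < 1, L := log(1/ε) with L ≥ 1, B > 0 real, κ := 6 + 2πB, and α ∈ ℂ with |α| ≥ 1/ε. Let U ⊆ ℂ be open, let w be analytic on U with w″(z) = 2·w(z)³ + 1 + (z/α)·w(z) on U, and let γ : [0,1] → U be a C¹ path of length at most 2πB such that for all t ∈ [0,1]: |γ(t)| ≤ 3ε·|α| and |w(γ(t))| ≤ L. Define E by 2E := w′(γ(0))² − w(γ(0))⁴ − 2·w(γ(0)), and suppose |P_E(w(γ(t)))| ≥ ε^{1/7} for all t. Let p : [0,1] → ℂ be continuous with p(t)² = P_E(w(γ(t))) and |w′(γ(t)) +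 p(t)| ≥ |p(t)| for all t. Then |∫₀¹ (w′(γ(t))/p(t))·γ′(t) dt − (γ(1) − γ(0))| ≤ 2π·κ·B·ε^{6/7}·L². -/
open Set

/-- Fundamental theorem of calculus along a path differentiable on `[0, 1]`, up to time `t`. -/
lemma integral_eq_sub_of_hasDerivWithinAt_Icc {f f' : ℝ → ℂ}
    (hf : ∀ s ∈ Icc (0 : ℝ) 1, HasDerivWithinAt f (f' s) (Icc (0 : ℝ) 1) s)
    (hf' : ContinuousOn f' (Icc (0 : ℝ) 1)) {t : ℝ} (ht : t ∈ Icc (0 : ℝ) 1) :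
    ∫ s in (0 : ℝ)..t, f' s = f t - f 0 := by
  have hsub : Icc 0 t ⊆ Icc (0 : ℝ) 1 := Icc_subset_Icc le_rfl ht.2
  refine intervalIntegral.integral_eq_sub_of_hasDerivAt_of_le ht.1
    (fun s hs => ((hf s (hsub hs)).continuousWithinAt).mono hsub) (fun s hs => ?_)
    ((hf'.mono hsub).intervalIntegrable_of_Icc ht.1)
  exact (hf s (hsub (Ioo_subset_Icc_self hs))).hasDerivAt
    (Icc_mem_nhds hs.1 (hs.2.trans_le ht.2))

/-- A bound for the integral along a path in terms of a bound of the integrand and the length. -/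
lemma norm_integral_mul_le_of_norm_le {g γ' : ℝ → ℂ} {C ℓ : ℝ} (hC : 0 ≤ C)
    (hγ' : ContinuousOn γ' (Icc (0 : ℝ) 1)) (hg : ∀ s ∈ Icc (0 : ℝ) 1, ‖g s‖ ≤ C)
    (hlen : (∫ s in (0 : ℝ)..1, ‖γ' s‖) ≤ ℓ) {t : ℝ} (ht : t ∈ Icc (0 : ℝ) 1) :
    ‖∫ s in (0 : ℝ)..t, g s * γ' s‖ ≤ C * ℓ := by
  have hsub : Icc 0 t ⊆ Icc (0 : ℝ) 1 := Icc_subset_Icc le_rfl ht.2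
  have hint : IntervalIntegrable (fun s => ‖γ' s‖) MeasureTheory.volume 0 1 :=
    hγ'.norm.intervalIntegrable_of_Icc zero_le_one
  have h1 : ‖∫ s in (0 : ℝ)..t, g s * γ' s‖ ≤ ∫ s in (0 : ℝ)..t, C * ‖γ' s‖ := by
    refine intervalIntegral.norm_integral_le_of_norm_le ht.1 ?_
      (((hγ'.norm.mono hsub).intervalIntegrable_of_Icc ht.1).const_mul C)
    refine Filter.Eventually.of_forall fun s hs => ?_
    rw [norm_mul]
    exact mul_le_mul_of_nonneg_right (hg s (hsub (Ioc_subset_Icc_self hs))) (norm_nonneg _)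
  have h2 : ∫ s in (0 : ℝ)..t, ‖γ' s‖ ≤ ∫ s in (0 : ℝ)..1, ‖γ' s‖ :=
    intervalIntegral.integral_mono_interval le_rfl ht.1 ht.2
      (Filter.Eventually.of_forall fun s => norm_nonneg _) hint
  rw [intervalIntegral.integral_const_mul] at h1
  exact h1.trans (mul_le_mul_of_nonneg_left (h2.trans hlen) hC)

/-- Along a path on which `|γ| ≤ 3ε|α|` and `|w| ≤ L`, the energy `w'² - w⁴ - 2w` of a solution of
the scaled second Painlevé equation varies by at most `(6 + 2πB)εL²`. -/
lemma norm_painleveII_energy_sub_le {ε L B : ℝ} (hε0 : 0 < ε)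
    {α : ℂ} (hα : 1 / ε ≤ ‖α‖) {U : Set ℂ} {w : ℂ → ℂ} (hw : ∀ z ∈ U, AnalyticAt ℂ w z)
    (hweq : ∀ z ∈ U, deriv (deriv w) z = 2 * w z ^ 3 + 1 + (z / α) * w z)
    {γ γ' : ℝ → ℂ} (hγU : ∀ t ∈ Icc (0 : ℝ) 1, γ t ∈ U)
    (hγd : ∀ t ∈ Icc (0 : ℝ) 1, HasDerivWithinAt γ (γ' t) (Icc (0 : ℝ) 1) t)
    (hγ'c : ContinuousOn γ' (Icc (0 : ℝ) 1))
    (hlen : (∫ t in (0 : ℝ)..1, ‖γ' t‖) ≤ 2 * Real.pi * B)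
    (hγb : ∀ t ∈ Icc (0 : ℝ) 1, ‖γ t‖ ≤ 3 * ε * ‖α‖)
    (hwb : ∀ t ∈ Icc (0 : ℝ) 1, ‖w (γ t)‖ ≤ L) {t : ℝ} (ht : t ∈ Icc (0 : ℝ) 1) :
    ‖(deriv w (γ t) ^ 2 - w (γ t) ^ 4 - 2 * w (γ t)) -
      (deriv w (γ 0) ^ 2 - w (γ 0) ^ 4 - 2 * w (γ 0))‖ ≤ (6 + 2 * Real.pi * B) * ε * L ^ 2 := by
  have hα0 : 0 < ‖α‖ := (one_div_pos.2 hε0).trans_le hα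
  have hw1 : ∀ s ∈ Icc (0 : ℝ) 1,
      HasDerivWithinAt (fun s => w (γ s)) (deriv w (γ s) * γ' s) (Icc (0 : ℝ) 1) s := fun s hs =>
    (hw _ (hγU s hs)).differentiableAt.hasDerivAt.comp_hasDerivWithinAt s (hγd s hs)
  have hw2 : ∀ s ∈ Icc (0 : ℝ) 1, HasDerivWithinAt (fun s => deriv w (γ s))
      (deriv (deriv w) (γ s) * γ' s) (Icc (0 : ℝ) 1) s := fun s hs =>
    (hw _ (hγU s hs)).deriv.differentiableAt.hasDerivAt.comp_hasDerivWithinAt s (hγd s hs)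
  have hwc : ContinuousOn (fun s => w (γ s)) (Icc (0 : ℝ) 1) :=
    fun s hs => (hw1 s hs).continuousWithinAt
  set F : ℝ → ℂ := fun s => deriv w (γ s) ^ 2 - w (γ s) ^ 4 - 2 * w (γ s) with hF
  have hG : ∀ s ∈ Icc (0 : ℝ) 1, HasDerivWithinAt (fun s => F s - γ s / α * w (γ s) ^ 2)
      (-(w (γ s) ^ 2 / α) * γ' s) (Icc (0 : ℝ) 1) s := by
    intro s hs
    refine (((((hw2 s hs).pow 2).sub ((hw1 s hs).pow 4)).sub ((hw1 s hs).const_mul 2)).sub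
      (((hγd s hs).div_const α).mul ((hw1 s hs).pow 2))).congr_deriv ?_
    rw [hweq _ (hγU s hs)]
    simp only [Nat.cast_ofNat, Pi.pow_apply]
    ring
  have hint := integral_eq_sub_of_hasDerivWithinAt_Icc hG
    ((((hwc.pow 2).div_const α).neg).mul hγ'c) ht
  have hsq : ∀ s ∈ Icc (0 : ℝ) 1, ‖w (γ s)‖ ^ 2 ≤ L ^ 2 := fun s hs =>
    pow_le_pow_left₀ (norm_nonneg _) (hwb s hs) 2
  have hinv : 1 / ‖α‖ ≤ ε := by
    rw [div_le_iff₀ hα0]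
    rwa [div_le_iff₀' hε0] at hα
  have hI := norm_integral_mul_le_of_norm_le (g := fun s => -(w (γ s) ^ 2 / α)) (C := ε * L ^ 2)
    (by positivity) hγ'c (fun s hs => by
      rw [norm_neg, norm_div, norm_pow, div_eq_mul_one_div, mul_comm]
      exact mul_le_mul hinv (hsq s hs) (by positivity) hε0.le) hlen ht
  have hb : ∀ s ∈ Icc (0 : ℝ) 1, ‖γ s / α * w (γ s) ^ 2‖ ≤ 3 * ε * L ^ 2 := fun s hs => by
    rw [norm_mul, norm_div, norm_pow]
    exact mul_le_mul ((div_le_iff₀ hα0).2 (hγb s hs)) (hsq s hs) (by positivity) (by positivity)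
  have heq : F t - F 0 = (∫ s in (0 : ℝ)..t, -(w (γ s) ^ 2 / α) * γ' s)
      + (γ t / α * w (γ t) ^ 2 - γ 0 / α * w (γ 0) ^ 2) := by
    rw [hint]; ring
  change ‖F t - F 0‖ ≤ _
  rw [heq]
  have h3 := norm_add_le (∫ s in (0 : ℝ)..t, -(w (γ s) ^ 2 / α) * γ' s)
    (γ t / α * w (γ t) ^ 2 - γ 0 / α * w (γ 0) ^ 2)
  have h4 := norm_sub_le (γ t / α * w (γ t) ^ 2) (γ 0 / α * w (γ 0) ^ 2)
  linarith [hb t ht, hb 0 (left_mem_Icc.2 zero_le_one)]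

/-- If `a² - p²` is at most `C` and `|a + p| ≥ |p|`, then `a / p` is within `C / |p|²` of `1`. -/
lemma norm_div_sub_one_le_of_norm_le_norm_add {a p : ℂ} {C δ : ℝ} (hδ : 0 < δ)
    (hp : δ ≤ ‖p ^ 2‖) (hbr : ‖p‖ ≤ ‖a + p‖) (hC : ‖a ^ 2 - p ^ 2‖ ≤ C) :
    ‖a / p - 1‖ ≤ C / δ := by
  have hp0 : p ≠ 0 := by
    rintro rfl
    simp at hp
    linarith
  have hpn : 0 < ‖p‖ := norm_pos_iff.2 hp0
  have hap : a + p ≠ 0 := norm_pos_iff.1 (hpn.trans_le hbr)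
  have : a / p - 1 = (a ^ 2 - p ^ 2) / (p * (a + p)) := by
    field_simp
    ring
  rw [this, norm_div, norm_mul]
  refine div_le_div₀ ((norm_nonneg _).trans hC) hC hδ (hp.trans ?_)
  rw [norm_pow, sq]
  exact mul_le_mul_of_nonneg_left hbr hpn.le

/-- Second estimate of Theorem 2.1: under the generic hypotheses,
if moreover `|P_E(w(γ(t)))| ≥ ε^{1/7}` along the path and `p` is the branch of
`√(P_E ∘ w ∘ γ)` with `|w′ + p| ≥ |p|`, then the incomplete elliptic integral
`∫₀¹ (w′(γ(t))/p(t))·γ′(t) dt` differs from `γ(1) − γ(0)` by at most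
`2πκB·ε^{6/7}·L²`. -/
theorem painleveII_generic_second_estimate
    (ε L B κ : ℝ) (hε0 : 0 < ε) (hε1 : ε < 1)
    (hL : L = Real.log (1 / ε)) (hL1 : 1 ≤ L)
    (hB : 0 < B) (hκ : κ = 6 + 2 * Real.pi * B)
    (α : ℂ) (hα : 1 / ε ≤ ‖α‖)
    (U : Set ℂ) (hU : IsOpen U)
    (w : ℂ → ℂ) (hw : ∀ z ∈ U, AnalyticAt ℂ w z)
    (hweq : ∀ z ∈ U, deriv (deriv w) z = 2 * w z ^ 3 + 1 + (z / α) * w z)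
    (γ γ' : ℝ → ℂ)
    (hγU : ∀ t ∈ Icc (0 : ℝ) 1, γ t ∈ U)
    (hγd : ∀ t ∈ Icc (0 : ℝ) 1, HasDerivWithinAt γ (γ' t) (Icc (0 : ℝ) 1) t)
    (hγ'c : ContinuousOn γ' (Icc (0 : ℝ) 1))
    (hlen : (∫ t in (0 : ℝ)..1, ‖γ' t‖) ≤ 2 * Real.pi * B)
    (hγb : ∀ t ∈ Icc (0 : ℝ) 1, ‖γ t‖ ≤ 3 * ε * ‖α‖)
    (hwb : ∀ t ∈ Icc (0 : ℝ) 1, ‖w (γ t)‖ ≤ L)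
    (E : ℂ) (hE : 2 * E = deriv w (γ 0) ^ 2 - w (γ 0) ^ 4 - 2 * w (γ 0))
    (hPb : ∀ t ∈ Icc (0 : ℝ) 1,
      ε ^ ((1 : ℝ) / 7) ≤ ‖w (γ t) ^ 4 + 2 * w (γ t) + 2 * E‖)
    (p : ℝ → ℂ) (hpc : ContinuousOn p (Icc (0 : ℝ) 1))
    (hp2 : ∀ t ∈ Icc (0 : ℝ) 1, p t ^ 2 = w (γ t) ^ 4 + 2 * w (γ t) + 2 * E)
    (hbranch : ∀ t ∈ Icc (0 : ℝ) 1, ‖p t‖ ≤ ‖deriv w (γ t) + p t‖) :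
    ‖(∫ t in (0 : ℝ)..1, (deriv w (γ t) / p t) * γ' t) - (γ 1 - γ 0)‖
      ≤ 2 * Real.pi * κ * B * ε ^ ((6 : ℝ) / 7) * L ^ 2 := by
  have hδ : 0 < ε ^ ((1 : ℝ) / 7) := Real.rpow_pos_of_pos hε0 _
  have hpi := Real.pi_pos
  have hκ0 : 0 ≤ κ := by rw [hκ]; positivity
  have hdiv : ε / ε ^ ((1 : ℝ) / 7) = ε ^ ((6 : ℝ) / 7) := by
    rw [div_eq_iff hδ.ne', ← Real.rpow_add hε0]
    norm_num
  have hquot : ∀ t ∈ Icc (0 : ℝ) 1,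
      ‖deriv w (γ t) / p t - 1‖ ≤ κ * ε ^ ((6 : ℝ) / 7) * L ^ 2 := by
    intro t ht
    have hP : ‖deriv w (γ t) ^ 2 - p t ^ 2‖ ≤ κ * ε * L ^ 2 := by
      have h := norm_painleveII_energy_sub_le hε0 hα hw hweq hγU hγd hγ'c hlen hγb hwb ht
      rw [← hE, ← hκ] at h
      rw [hp2 t ht]
      convert h using 2
      ring
    refine (norm_div_sub_one_le_of_norm_le_norm_add hδ (by rw [hp2 t ht]; exact hPb t ht)
      (hbranch t ht) hP).trans_eq ?_
    rw [← hdiv]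
    ring
  have hp0 : ∀ t ∈ Icc (0 : ℝ) 1, p t ≠ 0 := by
    intro t ht h0
    have h := hPb t ht
    rw [← hp2 t ht, h0] at h
    simp at h
    linarith
  have hγc : ContinuousOn γ (Icc (0 : ℝ) 1) := fun t ht => (hγd t ht).continuousWithinAt
  have hdc : ContinuousOn (fun t => deriv w (γ t)) (Icc (0 : ℝ) 1) := fun t ht =>
    (hw _ (hγU t ht)).deriv.continuousAt.comp_continuousWithinAt (hγc t ht)
  have h1 : (1 : ℝ) ∈ Icc (0 : ℝ) 1 := right_mem_Icc.2 zero_le_one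
  have hqc : ContinuousOn (fun t => deriv w (γ t) / p t * γ' t) (Icc (0 : ℝ) 1) :=
    (hdc.div hpc hp0).mul hγ'c
  rw [← integral_eq_sub_of_hasDerivWithinAt_Icc hγd hγ'c h1, ← intervalIntegral.integral_sub
    (hqc.intervalIntegrable_of_Icc zero_le_one)
    (hγ'c.intervalIntegrable_of_Icc zero_le_one)]
  simp_rw [← sub_one_mul]
  refine (norm_integral_mul_le_of_norm_le (by positivity) hγ'c hquot hlen h1).trans_eq ?_
  ring
end

section
/- Under the hypotheses of the second estimate of Theorem 2.1 — i.e. ε ∈ (0,1), L := log(1/ε) ≥ 1, B > 0, κ := 6 + 2πB, |α| ≥ 1/ε, w analytic on U solving w″ = 2w³ + 1 + (z/α)w, γ : [0,1] → U a C¹ path of length ≤ 2πB with |γ(t)| ≤ 3ε·|α|, |w(γ(t))| ≤ L and |P_E(w(γ(t)))| ≥ ε^{1/7} for all t (E defined by 2E := w′(γ(0))² − w(γ(0))⁴ − 2w(γ(0))), and p : [0,1] → ℂ continuous with p(t)² = P_E(w(γ(t))) and |w′(γ(t)) + p(t)| ≥ |p(t)| — assume additionally that w(γ(1)) = w(γ(0))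 and p(1) = p(0). Then, with the period ω := ∫₀¹ (w′(γ(t))/p(t))·γ′(t) dt, one has |(γ(1) − γ(0)) − ω| ≤ 2π·κ·B·ε^{6/7}·L². -/
open Set

/-- A function whose derivative is dominated by `C * ‖g'‖` on `[0, 1]` varies by at most
`C * ∫ ‖g'‖`. -/
lemma norm_sub_le_mul_integral_norm {G G' g' : ℝ → ℂ} {C : ℝ} (hC : 0 ≤ C)
    (hG : ∀ t ∈ Icc (0 : ℝ) 1, HasDerivWithinAt G (G' t) (Icc (0 : ℝ) 1) t)
    (hG' : ContinuousOn G' (Icc (0 : ℝ) 1)) (hg' : ContinuousOn g' (Icc (0 : ℝ) 1))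
    (hle : ∀ t ∈ Icc (0 : ℝ) 1, ‖G' t‖ ≤ C * ‖g' t‖) {t : ℝ} (ht : t ∈ Icc (0 : ℝ) 1) :
    ‖G t - G 0‖ ≤ C * ∫ s in (0 : ℝ)..1, ‖g' s‖ := by
  have hsub : Icc 0 t ⊆ Icc (0 : ℝ) 1 := Icc_subset_Icc_right ht.2
  have hint : IntervalIntegrable (fun s => ‖g' s‖) MeasureTheory.volume 0 1 :=
    hg'.norm.intervalIntegrable_of_Icc zero_le_one
  have hint' : IntervalIntegrable (fun s => ‖g' s‖) MeasureTheory.volume 0 t :=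
    (hg'.norm.mono hsub).intervalIntegrable_of_Icc ht.1
  have hFTC : ∫ s in (0 : ℝ)..t, G' s = G t - G 0 :=
    intervalIntegral.integral_eq_sub_of_hasDerivAt_of_le ht.1
      (fun s hs => ((hG s (hsub hs)).continuousWithinAt).mono hsub)
      (fun s hs => (hG s (hsub (Ioo_subset_Icc_self hs))).hasDerivAt
        (Icc_mem_nhds hs.1 (hs.2.trans_le ht.2)))
      ((hG'.mono hsub).intervalIntegrable_of_Icc ht.1)
  calc ‖G t - G 0‖ = ‖∫ s in (0 : ℝ)..t, G' s‖ := by rw [hFTC]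
    _ ≤ ∫ s in (0 : ℝ)..t, C * ‖g' s‖ :=
        intervalIntegral.norm_integral_le_of_norm_le ht.1
          (Filter.Eventually.of_forall fun s hs => hle s (hsub (Ioc_subset_Icc_self hs)))
          (hint'.const_mul C)
    _ = C * ∫ s in (0 : ℝ)..t, ‖g' s‖ := intervalIntegral.integral_const_mul ..
    _ ≤ C * ∫ s in (0 : ℝ)..1, ‖g' s‖ := by
        refine mul_le_mul_of_nonneg_left ?_ hC
        exact intervalIntegral.integral_mono_interval le_rfl ht.1 ht.2
          (Filter.Eventually.of_forall fun s => norm_nonneg _) hint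

/-- Third claim of Theorem 2.1: under the generic hypotheses,
if additionally `w(γ(1)) = w(γ(0))` and `p(1) = p(0)` (so the image of `γ` is a
closed contour on the Riemann surface of `√P_E`), then the spacing
`γ(1) − γ(0)` differs from the period `ω = ∫₀¹ (w′(γ(t))/p(t))·γ′(t) dt` by at
most `2πκB·ε^{6/7}·L²`. -/
theorem painleveII_period_estimate
    (ε L B κ : ℝ) (hε0 : 0 < ε) (hε1 : ε < 1)
    (hL : L = Real.log (1 / ε)) (hL1 : 1 ≤ L)
    (hB : 0 < B) (hκ : κ = 6 + 2 * Real.pi * B)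
    (α : ℂ) (hα : 1 / ε ≤ ‖α‖)
    (U : Set ℂ) (hU : IsOpen U)
    (w : ℂ → ℂ) (hw : ∀ z ∈ U, AnalyticAt ℂ w z)
    (hweq : ∀ z ∈ U, deriv (deriv w) z = 2 * w z ^ 3 + 1 + (z / α) * w z)
    (γ γ' : ℝ → ℂ)
    (hγU : ∀ t ∈ Icc (0 : ℝ) 1, γ t ∈ U)
    (hγd : ∀ t ∈ Icc (0 : ℝ) 1, HasDerivWithinAt γ (γ' t) (Icc (0 : ℝ) 1) t)
    (hγ'c : ContinuousOn γ' (Icc (0 : ℝ) 1))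
    (hlen : (∫ t in (0 : ℝ)..1, ‖γ' t‖) ≤ 2 * Real.pi * B)
    (hγb : ∀ t ∈ Icc (0 : ℝ) 1, ‖γ t‖ ≤ 3 * ε * ‖α‖)
    (hwb : ∀ t ∈ Icc (0 : ℝ) 1, ‖w (γ t)‖ ≤ L)
    (E : ℂ) (hE : 2 * E = deriv w (γ 0) ^ 2 - w (γ 0) ^ 4 - 2 * w (γ 0))
    (hPb : ∀ t ∈ Icc (0 : ℝ) 1,
      ε ^ ((1 : ℝ) / 7) ≤ ‖w (γ t) ^ 4 + 2 * w (γ t) + 2 * E‖)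
    (p : ℝ → ℂ) (hpc : ContinuousOn p (Icc (0 : ℝ) 1))
    (hp2 : ∀ t ∈ Icc (0 : ℝ) 1, p t ^ 2 = w (γ t) ^ 4 + 2 * w (γ t) + 2 * E)
    (hbranch : ∀ t ∈ Icc (0 : ℝ) 1, ‖p t‖ ≤ ‖deriv w (γ t) + p t‖)
    (hwcl : w (γ 1) = w (γ 0)) (hpcl : p 1 = p 0)
    (ω : ℂ) (hω : ω = ∫ t in (0 : ℝ)..1, (deriv w (γ t) / p t) * γ' t) :
    ‖(γ 1 - γ 0) - ω‖
      ≤ 2 * Real.pi * κ * B * ε ^ ((6 : ℝ) / 7) * L ^ 2 := by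
  have hα0 : 0 < ‖α‖ := (one_div_pos.2 hε0).trans_le hα
  have hα1 : 1 ≤ ε * ‖α‖ := by rwa [div_le_iff₀' hε0] at hα
  have hαinv : ‖α‖⁻¹ ≤ ε := by rwa [inv_le_iff_one_le_mul₀ hα0]
  have hκ0 : 0 ≤ κ := by rw [hκ]; positivity
  have h0 : (0 : ℝ) ∈ Icc (0 : ℝ) 1 := by simp
  have hγc : ContinuousOn γ (Icc (0 : ℝ) 1) := fun t ht => (hγd t ht).continuousWithinAt
  have hwc : ContinuousOn (fun t => w (γ t)) (Icc (0 : ℝ) 1) := fun t ht =>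
    ((hw _ (hγU t ht)).continuousAt).comp_continuousWithinAt (hγc t ht)
  have hw'c : ContinuousOn (fun t => deriv w (γ t)) (Icc (0 : ℝ) 1) := fun t ht =>
    ((hw _ (hγU t ht)).deriv.continuousAt).comp_continuousWithinAt (hγc t ht)
  have hwd : ∀ t ∈ Icc (0 : ℝ) 1,
      HasDerivWithinAt (fun t => w (γ t)) (deriv w (γ t) * γ' t) (Icc (0 : ℝ) 1) t :=
    fun t ht => (hw _ (hγU t ht)).differentiableAt.hasDerivAt.comp_hasDerivWithinAt t (hγd t ht)
  have hw'd : ∀ t ∈ Icc (0 : ℝ) 1, HasDerivWithinAt (fun t => deriv w (γ t))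
      ((2 * w (γ t) ^ 3 + 1 + (γ t / α) * w (γ t)) * γ' t) (Icc (0 : ℝ) 1) t := by
    intro t ht
    have h := (hw _ (hγU t ht)).deriv.differentiableAt.hasDerivAt
    rw [hweq _ (hγU t ht)] at h
    exact h.comp_hasDerivWithinAt t (hγd t ht)
  set G : ℝ → ℂ := fun t =>
    deriv w (γ t) ^ 2 - w (γ t) ^ 4 - 2 * w (γ t) - γ t / α * w (γ t) ^ 2 with hGdef
  have hGd : ∀ t ∈ Icc (0 : ℝ) 1,
      HasDerivWithinAt G (-(w (γ t) ^ 2 / α * γ' t)) (Icc (0 : ℝ) 1) t := by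
    intro t ht
    have h := ((((hw'd t ht).pow 2).sub ((hwd t ht).pow 4)).sub ((hwd t ht).const_mul 2)).sub
      (((hγd t ht).div_const α).mul ((hwd t ht).pow 2))
    refine h.congr_deriv ?_
    simp only [Pi.pow_apply]
    push_cast
    ring
  have hw2 : ∀ t ∈ Icc (0 : ℝ) 1, ‖w (γ t)‖ ^ 2 ≤ L ^ 2 := fun t ht =>
    pow_le_pow_left₀ (norm_nonneg _) (hwb t ht) 2
  have hGle : ∀ t ∈ Icc (0 : ℝ) 1, ‖G t - G 0‖ ≤ ε * L ^ 2 * (2 * Real.pi * B) := by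
    intro t ht
    refine (norm_sub_le_mul_integral_norm (C := ε * L ^ 2) (by positivity) hGd
      (((hwc.pow 2).div_const α).mul hγ'c).neg hγ'c (fun s hs => ?_) ht).trans
      (mul_le_mul_of_nonneg_left hlen (by positivity))
    rw [norm_neg, norm_mul, norm_div, norm_pow, div_eq_mul_inv, mul_comm ε]
    gcongr
    exact hwb s hs
  have hbd : ∀ t ∈ Icc (0 : ℝ) 1, ‖γ t / α * w (γ t) ^ 2‖ ≤ 3 * ε * L ^ 2 := by
    intro t ht
    rw [norm_mul, norm_div, norm_pow]
    have := hw2 t ht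
    gcongr
    rw [div_le_iff₀ hα0]
    exact hγb t ht
  have henergy : ∀ t ∈ Icc (0 : ℝ) 1, ‖deriv w (γ t) ^ 2 - p t ^ 2‖ ≤ κ * ε * L ^ 2 := by
    intro t ht
    have heq : deriv w (γ t) ^ 2 - p t ^ 2
        = (G t - G 0) + γ t / α * w (γ t) ^ 2 - γ 0 / α * w (γ 0) ^ 2 := by
      rw [hp2 t ht, hE, hGdef]
      ring
    rw [heq]
    calc _ ≤ ‖G t - G 0‖ + ‖γ t / α * w (γ t) ^ 2‖ + ‖γ 0 / α * w (γ 0) ^ 2‖ :=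
          (norm_sub_le _ _).trans (add_le_add_left (norm_add_le _ _) _)
      _ ≤ ε * L ^ 2 * (2 * Real.pi * B) + 3 * ε * L ^ 2 + 3 * ε * L ^ 2 :=
          add_le_add (add_le_add (hGle t ht) (hbd t ht)) (hbd 0 h0)
      _ = κ * ε * L ^ 2 := by rw [hκ]; ring
  have hpow : ε ^ ((6 : ℝ) / 7) * ε ^ ((1 : ℝ) / 7) = ε := by
    rw [← Real.rpow_add hε0]; norm_num
  have hε7 : 0 < ε ^ ((1 : ℝ) / 7) := Real.rpow_pos_of_pos hε0 _
  have hp2n : ∀ t ∈ Icc (0 : ℝ) 1, ε ^ ((1 : ℝ) / 7) ≤ ‖p t‖ ^ 2 := fun t ht => by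
    rw [← norm_pow, hp2 t ht]; exact hPb t ht
  have hp0 : ∀ t ∈ Icc (0 : ℝ) 1, p t ≠ 0 := fun t ht h => by
    have := hp2n t ht
    rw [h] at this
    norm_num at this
    linarith
  have hratio : ∀ t ∈ Icc (0 : ℝ) 1,
      ‖1 - deriv w (γ t) / p t‖ ≤ κ * ε ^ ((6 : ℝ) / 7) * L ^ 2 := by
    intro t ht
    have hpp : 0 < ‖p t‖ := norm_pos_iff.2 (hp0 t ht)
    have hfac : (1 - deriv w (γ t) / p t) * p t = -(deriv w (γ t) - p t) := by
      field_simp [hp0 t ht]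
      ring
    have hfacn : ‖1 - deriv w (γ t) / p t‖ * ‖p t‖ = ‖deriv w (γ t) - p t‖ := by
      rw [← norm_mul, hfac, norm_neg]
    have h1 : ‖1 - deriv w (γ t) / p t‖ * ‖p t‖ ^ 2 ≤ κ * ε * L ^ 2 := by
      calc _ = ‖deriv w (γ t) - p t‖ * ‖p t‖ := by rw [← hfacn]; ring
        _ ≤ ‖deriv w (γ t) - p t‖ * ‖deriv w (γ t) + p t‖ :=
            mul_le_mul_of_nonneg_left (hbranch t ht) (norm_nonneg _)
        _ = ‖deriv w (γ t) ^ 2 - p t ^ 2‖ := by rw [← norm_mul]; ring_nf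
        _ ≤ _ := henergy t ht
    refine le_of_mul_le_mul_right ?_ hε7
    calc _ ≤ ‖1 - deriv w (γ t) / p t‖ * ‖p t‖ ^ 2 :=
          mul_le_mul_of_nonneg_left (hp2n t ht) (norm_nonneg _)
      _ ≤ κ * ε * L ^ 2 := h1
      _ = κ * (ε ^ ((6 : ℝ) / 7) * ε ^ ((1 : ℝ) / 7)) * L ^ 2 := by rw [hpow]
      _ = _ := by ring
  have hqc : ContinuousOn (fun t => deriv w (γ t) / p t * γ' t) (Icc (0 : ℝ) 1) :=
    (hw'c.div hpc hp0).mul hγ'c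
  have hγint : ∫ t in (0 : ℝ)..1, γ' t = γ 1 - γ 0 :=
    intervalIntegral.integral_eq_sub_of_hasDerivAt_of_le zero_le_one hγc
      (fun t ht => (hγd t (Ioo_subset_Icc_self ht)).hasDerivAt (Icc_mem_nhds ht.1 ht.2))
      (hγ'c.intervalIntegrable_of_Icc zero_le_one)
  rw [← hγint, hω, ← intervalIntegral.integral_sub
    (hγ'c.intervalIntegrable_of_Icc zero_le_one) (hqc.intervalIntegrable_of_Icc zero_le_one)]
  calc _ ≤ ∫ t in (0 : ℝ)..1, κ * ε ^ ((6 : ℝ) / 7) * L ^ 2 * ‖γ' t‖ := by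
        refine intervalIntegral.norm_integral_le_of_norm_le zero_le_one
          (Filter.Eventually.of_forall fun t ht => ?_)
          ((hγ'c.norm.intervalIntegrable_of_Icc zero_le_one).const_mul _)
        rw [← one_sub_mul, norm_mul]
        exact mul_le_mul_of_nonneg_right (hratio t (Ioc_subset_Icc_self ht)) (norm_nonneg _)
    _ = κ * ε ^ ((6 : ℝ) / 7) * L ^ 2 * ∫ t in (0 : ℝ)..1, ‖γ' t‖ :=
        intervalIntegral.integral_const_mul ..
    _ ≤ κ * ε ^ ((6 : ℝ) / 7) * L ^ 2 * (2 * Real.pi * B) :=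
        mul_le_mul_of_nonneg_left hlen (by positivity)
    _ = _ := by ring
end

section
/- Let ε ∈ ℝ with 0 < ε < 1, L := log(1/ε) with L ≥ 1, B > 0 real, κ := 6 + 2πB, and α ∈ ℂ with |α| ≥ 1/ε. Let E, e ∈ ℂ with e⁴ = E, |E| ≥ L⁴ and κ·ε ≤ |E|^{−1/2}. Let U ⊆ ℂ be open, let q be analytic on U with q″(s) = 2·q(s)³ + (1 + s·q(s)/α)/e³ for all s ∈ U, and let σ : [0,1] → U be a C¹ path of length at most 2πB such that for all t ∈ [0,1]: |q(σ(t))| ≤ |e| and |σ(t)/(e·α)| ≤ 3ε. Assume the energy normalization q′(σ(0))² = q(σ(0))⁴ + 2 + 2·q(σ(0))/e³. Then: (i) |q′(σ(1))² − (q(σ(1))⁴ + 2)| ≤ 3·|E|^{−1/2}; and (ii) if moreover |q(σ(t))⁴ + 2| ≥ |E|^{−1/4} for all t, and p : [0,1] → ℂ is continuous with p(t)² = q(σ(t))⁴ + 2 and |q′(σ(t)) + p(t)| ≥ |p(t)| for all t, then |∫₀¹ (q′(σ(t))/p(t))·σ′(t) dt − (σ(1) − σ(0))| ≤ 6π·B·|E|^{−1/4}.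 -/
open Set

/-- If `‖f‖ ≤ C ‖g‖` on `[0, 1]` and `t ∈ [0, 1]`, then `‖∫₀ᵗ f‖ ≤ C ∫₀¹ ‖g‖`. -/
lemma norm_intervalIntegral_le_mul_integral_norm {f g : ℝ → ℂ} {C t : ℝ}
    (hC : 0 ≤ C) (ht : t ∈ Icc (0 : ℝ) 1)
    (hf : ContinuousOn f (Icc (0 : ℝ) 1)) (hg : ContinuousOn g (Icc (0 : ℝ) 1))
    (h : ∀ x ∈ Icc (0 : ℝ) 1, ‖f x‖ ≤ C * ‖g x‖) :
    ‖∫ x in (0 : ℝ)..t, f x‖ ≤ C * ∫ x in (0 : ℝ)..1, ‖g x‖ := by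
  have hsub : Icc 0 t ⊆ Icc (0 : ℝ) 1 := Icc_subset_Icc_right ht.2
  have hgi : IntervalIntegrable (fun x => ‖g x‖) MeasureTheory.volume 0 1 :=
    hg.norm.intervalIntegrable_of_Icc zero_le_one
  calc ‖∫ x in (0 : ℝ)..t, f x‖ ≤ ∫ x in (0 : ℝ)..t, ‖f x‖ :=
        intervalIntegral.norm_integral_le_integral_norm ht.1
    _ ≤ ∫ x in (0 : ℝ)..t, C * ‖g x‖ :=
        intervalIntegral.integral_mono_on ht.1
          ((hf.mono hsub).norm.intervalIntegrable_of_Icc ht.1)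
          (((hg.mono hsub).norm.intervalIntegrable_of_Icc ht.1).const_mul C)
          (fun x hx => h x (hsub hx))
    _ = C * ∫ x in (0 : ℝ)..t, ‖g x‖ := intervalIntegral.integral_const_mul _ _
    _ ≤ C * ∫ x in (0 : ℝ)..1, ‖g x‖ := by
        gcongr
        exact intervalIntegral.integral_mono_interval le_rfl ht.1 ht.2
          (Filter.Eventually.of_forall fun x => norm_nonneg _) hgi

/-- The first integral of `q″ = 2q³ + (1 + s q/α)/c` along a path, with the term
`∫ s q q′ ds` integrated by parts. -/
lemma painleveII_first_integral_along_path {α c : ℂ} {U : Set ℂ}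
    {q : ℂ → ℂ} (hq : ∀ s ∈ U, AnalyticAt ℂ q s)
    (hqeq : ∀ s ∈ U, deriv (deriv q) s = 2 * q s ^ 3 + (1 + s * q s / α) / c)
    {σ σ' : ℝ → ℂ}
    (hσU : ∀ t ∈ Icc (0 : ℝ) 1, σ t ∈ U)
    (hσd : ∀ t ∈ Icc (0 : ℝ) 1, HasDerivWithinAt σ (σ' t) (Icc (0 : ℝ) 1) t)
    (hσ'c : ContinuousOn σ' (Icc (0 : ℝ) 1))
    (hE0 : deriv q (σ 0) ^ 2 = q (σ 0) ^ 4 + 2 + 2 * q (σ 0) / c)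
    {t : ℝ} (ht : t ∈ Icc (0 : ℝ) 1) :
    deriv q (σ t) ^ 2 - (q (σ t) ^ 4 + 2) =
      2 * q (σ t) / c + σ t * q (σ t) ^ 2 / (α * c) - σ 0 * q (σ 0) ^ 2 / (α * c)
        - ∫ x in (0 : ℝ)..t, q (σ x) ^ 2 / (α * c) * σ' x := by
  have hsub : Icc 0 t ⊆ Icc (0 : ℝ) 1 := Icc_subset_Icc_right ht.2
  have hqσ : ∀ x ∈ Icc (0 : ℝ) 1, HasDerivWithinAt (fun y => q (σ y))
      (deriv q (σ x) * σ' x) (Icc (0 : ℝ) 1) x := fun x hx =>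
    (hq _ (hσU x hx)).differentiableAt.hasDerivAt.comp_hasDerivWithinAt x (hσd x hx)
  have hq'σ : ∀ x ∈ Icc (0 : ℝ) 1, HasDerivWithinAt (fun y => deriv q (σ y))
      (deriv (deriv q) (σ x) * σ' x) (Icc (0 : ℝ) 1) x := fun x hx =>
    (hq _ (hσU x hx)).deriv.differentiableAt.hasDerivAt.comp_hasDerivWithinAt x (hσd x hx)
  have hqc : ContinuousOn (fun y => q (σ y)) (Icc (0 : ℝ) 1) :=
    fun x hx => (hqσ x hx).continuousWithinAt
  have hF : ∀ x ∈ Icc (0 : ℝ) 1, HasDerivWithinAt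
      (fun y => 2 * q (σ y) / c + σ y * q (σ y) ^ 2 / (α * c)
        - (deriv q (σ y) ^ 2 - (q (σ y) ^ 4 + 2)))
      (q (σ x) ^ 2 / (α * c) * σ' x) (Icc (0 : ℝ) 1) x := by
    intro x hx
    have h1 := hqσ x hx
    refine ((((h1.const_mul 2).div_const c).add
      (((hσd x hx).mul (h1.pow 2)).div_const (α * c))).sub
      (((hq'σ x hx).pow 2).sub ((h1.pow 4).add_const 2))).congr_deriv ?_
    rw [hqeq _ (hσU x hx)]
    simp only [Pi.pow_apply, div_eq_mul_inv, mul_inv]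
    push_cast
    ring
  have hint := intervalIntegral.integral_eq_sub_of_hasDerivAt_of_le ht.1
    (fun x hx => ((hF x (hsub hx)).continuousWithinAt).mono hsub)
    (fun x hx => (hF x (hsub (Ioo_subset_Icc_self hx))).hasDerivAt
      (Icc_mem_nhds hx.1 (hx.2.trans_le ht.2)))
    ((((hqc.pow 2).div_const (α * c)).mul hσ'c |>.mono hsub).intervalIntegrable_of_Icc ht.1)
  rw [hint, hE0]
  ring

/-- Theorem 3.5 (large energy limit): after the rescaling
`w = e·q(s)`, `s = e·z` with `e⁴ = E`, `|E| ≥ L⁴`, the rescaled equation is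
`q″ = 2q³ + (1 + s·q/α)/e³`, and along a path of length at most `2πB`:
(i) `|q′² − (q⁴ + 2)| ≤ 3|E|^{−1/2}`; and (ii) if `|q⁴ + 2| ≥ |E|^{−1/4}` along
the path and `p` is the branch of `√(q⁴ + 2)` with `|q′ + p| ≥ |p|`, then
`|∫₀¹ (q′/p)·σ′ dt − (σ(1) − σ(0))| ≤ 6πB·|E|^{−1/4}`. -/
theorem painleveII_large_energy_estimates
    (ε L B κ : ℝ) (hε0 : 0 < ε) (hε1 : ε < 1)
    (hL : L = Real.log (1 / ε)) (hL1 : 1 ≤ L)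
    (hB : 0 < B) (hκ : κ = 6 + 2 * Real.pi * B)
    (α : ℂ) (hα : 1 / ε ≤ ‖α‖)
    (E e : ℂ) (he : e ^ 4 = E) (hE : L ^ 4 ≤ ‖E‖)
    (hκε : κ * ε ≤ ‖E‖ ^ (-(1 : ℝ) / 2))
    (U : Set ℂ) (hU : IsOpen U)
    (q : ℂ → ℂ) (hq : ∀ s ∈ U, AnalyticAt ℂ q s)
    (hqeq : ∀ s ∈ U, deriv (deriv q) s = 2 * q s ^ 3 + (1 + s * q s / α) / e ^ 3)
    (σ σ' : ℝ → ℂ)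
    (hσU : ∀ t ∈ Icc (0 : ℝ) 1, σ t ∈ U)
    (hσd : ∀ t ∈ Icc (0 : ℝ) 1, HasDerivWithinAt σ (σ' t) (Icc (0 : ℝ) 1) t)
    (hσ'c : ContinuousOn σ' (Icc (0 : ℝ) 1))
    (hlen : (∫ t in (0 : ℝ)..1, ‖σ' t‖) ≤ 2 * Real.pi * B)
    (hqb : ∀ t ∈ Icc (0 : ℝ) 1, ‖q (σ t)‖ ≤ ‖e‖)
    (hσb : ∀ t ∈ Icc (0 : ℝ) 1, ‖σ t / (e * α)‖ ≤ 3 * ε)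
    (hE0 : deriv q (σ 0) ^ 2 = q (σ 0) ^ 4 + 2 + 2 * q (σ 0) / e ^ 3) :
    ‖deriv q (σ 1) ^ 2 - (q (σ 1) ^ 4 + 2)‖ ≤ 3 * ‖E‖ ^ (-(1 : ℝ) / 2) ∧
    (∀ p : ℝ → ℂ,
      (∀ t ∈ Icc (0 : ℝ) 1, ‖E‖ ^ (-(1 : ℝ) / 4) ≤ ‖q (σ t) ^ 4 + 2‖) →
      ContinuousOn p (Icc (0 : ℝ) 1) →
      (∀ t ∈ Icc (0 : ℝ) 1, p t ^ 2 = q (σ t) ^ 4 + 2) →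
      (∀ t ∈ Icc (0 : ℝ) 1, ‖p t‖ ≤ ‖deriv q (σ t) + p t‖) →
      ‖(∫ t in (0 : ℝ)..1, (deriv q (σ t) / p t) * σ' t) - (σ 1 - σ 0)‖
        ≤ 6 * Real.pi * B * ‖E‖ ^ (-(1 : ℝ) / 4)) := by
  have hL4 : (1 : ℝ) ≤ ‖e‖ ^ 4 := by
    rw [← norm_pow, he]
    exact (one_le_pow₀ hL1).trans hE
  have hm1 : 1 ≤ ‖e‖ := (one_le_pow_iff_of_nonneg (norm_nonneg e) four_ne_zero).1 hL4
  have hm0 : 0 < ‖e‖ := one_pos.trans_le hm1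
  have hE2 : ‖E‖ ^ (-(1 : ℝ) / 2) = 1 / ‖e‖ ^ 2 := by
    rw [← he, norm_pow, ← Real.rpow_natCast, ← Real.rpow_mul hm0.le, one_div,
      ← Real.rpow_natCast, ← Real.rpow_neg hm0.le]
    norm_num
  have hE4 : ‖E‖ ^ (-(1 : ℝ) / 4) = 1 / ‖e‖ := by
    rw [← he, norm_pow, ← Real.rpow_natCast, ← Real.rpow_mul hm0.le, one_div,
      ← Real.rpow_neg_one]
    norm_num
  have hα0 : 0 < ‖α‖ := (one_div_pos.2 hε0).trans_le hα
  have hαi : 1 / ‖α‖ ≤ ε := (one_div_le hα0 hε0).2 hα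
  have hσc : ContinuousOn σ (Icc (0 : ℝ) 1) := fun x hx => (hσd x hx).continuousWithinAt
  have hqc : ContinuousOn (fun y => q (σ y)) (Icc (0 : ℝ) 1) := fun x hx =>
    (hq _ (hσU x hx)).continuousAt.comp_continuousWithinAt (hσc x hx)
  have hq'c : ContinuousOn (fun y => deriv q (σ y)) (Icc (0 : ℝ) 1) := fun x hx =>
    (hq _ (hσU x hx)).deriv.continuousAt.comp_continuousWithinAt (hσc x hx)
  have hsq : ∀ t ∈ Icc (0 : ℝ) 1, ‖σ t * q (σ t) ^ 2 / (α * e ^ 3)‖ ≤ 3 * ε := by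
    intro t ht
    have hqe : ‖q (σ t) / e‖ ≤ 1 := by
      rw [norm_div]
      exact div_le_one_of_le₀ (hqb t ht) hm0.le
    have : σ t * q (σ t) ^ 2 / (α * e ^ 3) = σ t / (e * α) * (q (σ t) / e) ^ 2 := by
      simp only [div_eq_mul_inv, mul_inv]
      ring
    rw [this, norm_mul, norm_pow]
    exact (mul_le_of_le_one_right (norm_nonneg _) (pow_le_one₀ (norm_nonneg _) hqe)).trans
      (hσb t ht)
  have hmain : ∀ t ∈ Icc (0 : ℝ) 1,
      ‖deriv q (σ t) ^ 2 - (q (σ t) ^ 4 + 2)‖ ≤ 3 * (1 / ‖e‖ ^ 2) := by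
    intro t ht
    rw [painleveII_first_integral_along_path hq hqeq hσU hσd hσ'c hE0 ht]
    have h1 : ‖2 * q (σ t) / e ^ 3‖ ≤ 2 * (1 / ‖e‖ ^ 2) := by
      rw [norm_div, norm_mul, norm_pow, RCLike.norm_ofNat]
      calc 2 * ‖q (σ t)‖ / ‖e‖ ^ 3 ≤ 2 * ‖e‖ / ‖e‖ ^ 3 := by
            gcongr
            exact hqb t ht
        _ = 2 * (1 / ‖e‖ ^ 2) := by field_simp
    have h2 : ‖∫ x in (0 : ℝ)..t, q (σ x) ^ 2 / (α * e ^ 3) * σ' x‖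
        ≤ 2 * Real.pi * B * ε := by
      calc _ ≤ ε * ∫ x in (0 : ℝ)..1, ‖σ' x‖ := by
            refine norm_intervalIntegral_le_mul_integral_norm hε0.le ht
              (((hqc.pow 2).div_const _).mul hσ'c) hσ'c fun x hx => ?_
            rw [norm_mul, norm_div, norm_mul, norm_pow, norm_pow]
            gcongr
            calc ‖q (σ x)‖ ^ 2 / (‖α‖ * ‖e‖ ^ 3) ≤ ‖e‖ ^ 2 / (‖α‖ * ‖e‖ ^ 3) := by
                  gcongr
                  exact hqb x hx
              _ = 1 / ‖α‖ * (1 / ‖e‖) := by field_simp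
              _ ≤ 1 / ‖α‖ :=
                  mul_le_of_le_one_right (by positivity) (div_le_one_of_le₀ hm1 hm0.le)
              _ ≤ ε := hαi
        _ ≤ ε * (2 * Real.pi * B) := by gcongr
        _ = 2 * Real.pi * B * ε := mul_comm _ _
    have h3 := hsq t ht
    have h4 := hsq 0 (left_mem_Icc.2 zero_le_one)
    have h5 := norm_sub_le (2 * q (σ t) / e ^ 3 + σ t * q (σ t) ^ 2 / (α * e ^ 3)
      - σ 0 * q (σ 0) ^ 2 / (α * e ^ 3)) (∫ x in (0 : ℝ)..t, q (σ x) ^ 2 / (α * e ^ 3) * σ' x)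
    have h6 := norm_sub_le (2 * q (σ t) / e ^ 3 + σ t * q (σ t) ^ 2 / (α * e ^ 3))
      (σ 0 * q (σ 0) ^ 2 / (α * e ^ 3))
    have h7 := norm_add_le (2 * q (σ t) / e ^ 3) (σ t * q (σ t) ^ 2 / (α * e ^ 3))
    rw [hκ, hE2] at hκε
    linarith
  rw [hE2, hE4]
  refine ⟨hmain 1 (right_mem_Icc.2 zero_le_one), fun p hlow hpc hp hbr => ?_⟩
  have hpsq : ∀ t ∈ Icc (0 : ℝ) 1, 1 / ‖e‖ ≤ ‖p t‖ ^ 2 := fun t ht => by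
    rw [← norm_pow, hp t ht]
    exact hlow t ht
  have hp0 : ∀ t ∈ Icc (0 : ℝ) 1, p t ≠ 0 := fun t ht h => by
    have := hpsq t ht
    rw [h, norm_zero, zero_pow two_ne_zero] at this
    exact this.not_gt (one_div_pos.2 hm0)
  have hfc : ContinuousOn (fun t => deriv q (σ t) / p t * σ' t) (Icc (0 : ℝ) 1) :=
    (hq'c.div hpc hp0).mul hσ'c
  have hσint : ∫ t in (0 : ℝ)..1, σ' t = σ 1 - σ 0 :=
    intervalIntegral.integral_eq_sub_of_hasDerivAt_of_le zero_le_one hσc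
      (fun x hx => (hσd x (Ioo_subset_Icc_self hx)).hasDerivAt (Icc_mem_nhds hx.1 hx.2))
      (hσ'c.intervalIntegrable_of_Icc zero_le_one)
  rw [← hσint, ← intervalIntegral.integral_sub (hfc.intervalIntegrable_of_Icc zero_le_one)
    (hσ'c.intervalIntegrable_of_Icc zero_le_one)]
  calc _ ≤ 3 * (1 / ‖e‖) * ∫ x in (0 : ℝ)..1, ‖σ' x‖ := by
        refine norm_intervalIntegral_le_mul_integral_norm (by positivity)
          (right_mem_Icc.2 zero_le_one) (hfc.sub hσ'c) hσ'c fun t ht => ?_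
        have hpt := hp0 t ht
        have hpn : 0 < ‖p t‖ := norm_pos_iff.2 hpt
        have hfac : deriv q (σ t) / p t * σ' t - σ' t
            = (deriv q (σ t) - p t) / p t * σ' t := by
          field_simp
        rw [hfac, norm_mul, norm_div]
        gcongr
        have hdiff : ‖deriv q (σ t) - p t‖ * ‖p t‖ ≤ 3 * (1 / ‖e‖ ^ 2) := by
          calc _ ≤ ‖deriv q (σ t) - p t‖ * ‖deriv q (σ t) + p t‖ := by
                gcongr
                exact hbr t ht
            _ = ‖deriv q (σ t) ^ 2 - (q (σ t) ^ 4 + 2)‖ := by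
                rw [← norm_mul, ← hp t ht]
                congr 1
                ring
            _ ≤ _ := hmain t ht
        rw [div_le_iff₀ hpn]
        refine le_of_mul_le_mul_right ?_ hpn
        calc _ ≤ 3 * (1 / ‖e‖ ^ 2) := hdiff
          _ = 3 * (1 / ‖e‖) * (1 / ‖e‖) := by field_simp
          _ ≤ 3 * (1 / ‖e‖) * ‖p t‖ ^ 2 := by
              gcongr
              exact hpsq t ht
          _ = 3 * (1 / ‖e‖) * ‖p t‖ * ‖p t‖ := by ring
    _ ≤ 3 * (1 / ‖e‖) * (2 * Real.pi * B) := by gcongr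
    _ = 6 * Real.pi * B * (1 / ‖e‖) := by ring
end

section
/- Let E ∈ ℂ, let γ : [0,1] → ℂ be a C¹ path with γ(1) = γ(0), and let p : [0,1] → ℂ be continuous with p(t)² = γ(t)⁴ + 2·γ(t) + 2E ≠ 0 for all t and p(1) = p(0). Define ω := ∫₀¹ γ′(t)/p(t) dt, ψ := ∫₀¹ γ(t)²·γ′(t)/p(t) dt and ψ̃ := ∫₀¹ γ(t)²·p(t)·γ′(t) dt. Then 3·ω = 8·E·ψ − 10·ψ̃. -/
open Set

/-- A continuous square root of a differentiable function is differentiable where it does not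
vanish. -/
theorem HasDerivWithinAt.of_sq_of_continuousWithinAt {𝕜 : Type*} [NontriviallyNormedField 𝕜]
    {𝕜' : Type*} [NormedField 𝕜'] [NormedAlgebra 𝕜 𝕜'] [NeZero (2 : 𝕜')]
    {p : 𝕜 → 𝕜'} {q' : 𝕜'} {s : Set 𝕜} {t : 𝕜}
    (hq : HasDerivWithinAt (fun x => p x ^ 2) q' s t)
    (hp : ContinuousWithinAt p s t) (h0 : p t ≠ 0) :
    HasDerivWithinAt p (q' / (2 * p t)) s t := by
  have h2 : p t + p t ≠ 0 := by
    rw [← two_mul]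
    exact mul_ne_zero two_ne_zero h0
  rw [hasDerivWithinAt_iff_tendsto_slope] at hq ⊢
  have hsum : Filter.Tendsto (fun x => p x + p t) (nhdsWithin t (s \ {t})) (nhds (p t + p t)) :=
    (hp.tendsto.mono_left (nhdsWithin_mono _ sdiff_subset)).add_const _
  rw [two_mul]
  refine (hq.div hsum h2).congr' ?_
  filter_upwards [hsum.eventually_ne h2] with x hx
  simp only [slope, vsub_eq_sub, Pi.div_apply]
  rw [div_eq_iff hx, smul_mul_assoc]
  congr 1
  ring

/-- Relation (A.1) between complete elliptic integrals over a
closed loop on the Riemann surface of `√(v⁴ + 2v + 2E)`: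
`3ω = 8Eψ − 10ψ̃` where `ω = ∮ dv/√P_E`, `ψ = ∮ v² dv/√P_E`,
`ψ̃ = ∮ v²√P_E dv`. -/
theorem elliptic_integral_relation_A1
    (E : ℂ) (γ γ' p : ℝ → ℂ)
    (hγd : ∀ t ∈ Icc (0 : ℝ) 1, HasDerivWithinAt γ (γ' t) (Icc (0 : ℝ) 1) t)
    (hγ'c : ContinuousOn γ' (Icc (0 : ℝ) 1))
    (hγcl : γ 1 = γ 0)
    (hpc : ContinuousOn p (Icc (0 : ℝ) 1))
    (hp2 : ∀ t ∈ Icc (0 : ℝ) 1,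
      p t ^ 2 = γ t ^ 4 + 2 * γ t + 2 * E ∧ γ t ^ 4 + 2 * γ t + 2 * E ≠ 0)
    (hpcl : p 1 = p 0) :
    3 * (∫ t in (0 : ℝ)..1, γ' t / p t)
      = 8 * E * (∫ t in (0 : ℝ)..1, γ t ^ 2 * γ' t / p t)
        - 10 * (∫ t in (0 : ℝ)..1, γ t ^ 2 * p t * γ' t) := by
  have hγc : ContinuousOn γ (Icc (0 : ℝ) 1) := fun t ht => (hγd t ht).continuousWithinAt
  have hp0 : ∀ t ∈ Icc (0 : ℝ) 1, p t ≠ 0 := fun t ht h =>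
    (hp2 t ht).2 (by rw [← (hp2 t ht).1, h]; ring)
  have hpd : ∀ t ∈ Icc (0 : ℝ) 1, HasDerivWithinAt p
      ((4 * γ t ^ 3 * γ' t + 2 * γ' t) / (2 * p t)) (Icc (0 : ℝ) 1) t := by
    intro t ht
    refine HasDerivWithinAt.of_sq_of_continuousWithinAt ?_ (hpc t ht) (hp0 t ht)
    have h := (((hγd t ht).pow 4).add ((hγd t ht).const_mul 2)).add_const (2 * E)
    refine (h.congr_of_mem (fun x hx => (hp2 x hx).1) ht).congr_deriv ?_
    norm_num
  have i1 : IntervalIntegrable (fun t => γ' t / p t) MeasureTheory.volume 0 1 :=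
    (hγ'c.div hpc hp0).intervalIntegrable_of_Icc zero_le_one
  have i2 : IntervalIntegrable (fun t => γ t ^ 2 * γ' t / p t) MeasureTheory.volume 0 1 :=
    (((hγc.pow 2).mul hγ'c).div hpc hp0).intervalIntegrable_of_Icc zero_le_one
  have i3 : IntervalIntegrable (fun t => γ t ^ 2 * p t * γ' t) MeasureTheory.volume 0 1 :=
    (((hγc.pow 2).mul hpc).mul hγ'c).intervalIntegrable_of_Icc zero_le_one
  have hF : ∀ t ∈ Ioo (0 : ℝ) 1, HasDerivAt (fun t => (2 * γ t ^ 3 + 3) * p t)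
      (3 * (γ' t / p t) - 8 * E * (γ t ^ 2 * γ' t / p t) + 10 * (γ t ^ 2 * p t * γ' t)) t := by
    intro t ht
    have ht' := Ioo_subset_Icc_self ht
    have h := (((((hγd t ht').pow 3).const_mul 2).add_const 3).mul (hpd t ht')).hasDerivAt
      (Icc_mem_nhds ht.1 ht.2)
    refine h.congr_deriv ?_
    have := hp0 t ht'
    have hsq := (hp2 t ht').1
    simp only [Pi.pow_apply]
    field_simp
    push_cast
    linear_combination (-8 * γ t ^ 2 * γ' t) * hsq
  have key := intervalIntegral.integral_eq_sub_of_hasDerivAt_of_le zero_le_one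
    ((((hγc.pow 3).const_mul 2).add continuousOn_const).mul hpc) hF
    (((i1.const_mul 3).sub (i2.const_mul (8 * E))).add (i3.const_mul 10))
  rw [intervalIntegral.integral_add ((i1.const_mul 3).sub (i2.const_mul (8 * E)))
      (i3.const_mul 10),
    intervalIntegral.integral_sub (i1.const_mul 3) (i2.const_mul (8 * E))] at key
  simp only [intervalIntegral.integral_const_mul, Pi.mul_apply, Pi.add_apply, Pi.pow_apply, hγcl, hpcl,
    sub_self] at key
  linear_combination key
end

section
/- Let E ∈ ℂ, let γ : [0,1] → ℂ be a C¹ path with γ(1) = γ(0), and let p : [0,1] → ℂ be continuous with p(t)² = γ(t)⁴ + 2·γ(t) + 2E ≠ 0 for all t and p(1) = p(0). Define ω := ∫₀¹ γ′/p dt, ω̃ := ∫₀¹ p·γ′ dt, φ := ∫₀¹ γ·γ′/p dt, φ̃ := ∫₀¹ γ·p·γ′ dt, ψ := ∫₀¹ γ²·γ′/p dt, A := ∫₀¹ γ²·γ′/p³ dt and Bʹ := ∫₀¹ γ·γ′/p³ dt. Then: (i) 3·ω̃ = 3·φ + 4·E·ω; (ii) 2·φ̃ = (3/2)·ψ + 2·E·φ;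 and (iii) 3·A = −4·E·Bʹ. -/
open Set Filter Topology

/-- A continuous square root of a differentiable function is differentiable wherever it does not
vanish. -/
theorem HasDerivWithinAt.of_sq {f p : ℝ → ℂ} {f' : ℂ} {s : Set ℝ} {t : ℝ}
    (hf : HasDerivWithinAt f f' s t) (hp : ContinuousWithinAt p s t) (ht : t ∈ s)
    (hsq : ∀ x ∈ s, p x ^ 2 = f x) (h0 : p t ≠ 0) :
    HasDerivWithinAt p (f' / (2 * p t)) s t := by
  rw [hasDerivWithinAt_iff_tendsto_slope] at hf ⊢
  have hsum : Tendsto (fun x => p x + p t) (𝓝[s \ {t}] t) (𝓝 (2 * p t)) := by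
    rw [two_mul]
    exact (hp.mono_left (nhdsWithin_mono t sdiff_subset)).add_const (p t)
  have h2 : 2 * p t ≠ 0 := mul_ne_zero two_ne_zero h0
  refine (hf.div hsum h2).congr' ?_
  filter_upwards [hsum.eventually_ne h2, self_mem_nhdsWithin] with x hx hxs
  rw [Pi.div_apply, div_eq_iff hx, slope_def_module, slope_def_module, ← hsq x hxs.1, ← hsq t ht,
    smul_mul_assoc]
  congr 1
  ring

/-- The derivative of a function with equal endpoint values has integral zero. -/
theorem intervalIntegral_eq_zero_of_hasDerivWithinAt {F F' : ℝ → ℂ} {a b : ℝ} (hab : a ≤ b)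
    (hF : ∀ t ∈ Icc a b, HasDerivWithinAt F (F' t) (Icc a b) t)
    (hF' : ContinuousOn F' (Icc a b)) (hcl : F b = F a) :
    ∫ t in a..b, F' t = 0 := by
  rw [intervalIntegral.integral_eq_sub_of_hasDerivAt_of_le hab
    (fun t ht => (hF t ht).continuousWithinAt)
    (fun t ht => (hF t (Ioo_subset_Icc_self ht)).hasDerivAt (Icc_mem_nhds ht.1 ht.2))
    (hF'.intervalIntegrable_of_Icc hab), hcl, sub_self]

/-- Relations (A.2), (A.3), (A.4) between complete elliptic
integrals over a closed loop on the Riemann surface of `√(v⁴ + 2v + 2E)`: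
(i) `3ω̃ = 3φ + 4Eω`; (ii) `2φ̃ = (3/2)ψ + 2Eφ`; (iii) `3A = −4EB′`, where
`ω = ∮ dv/√P_E`, `ω̃ = ∮ √P_E dv`, `φ = ∮ v dv/√P_E`, `φ̃ = ∮ v√P_E dv`,
`ψ = ∮ v² dv/√P_E`, `A = ∮ v² dv/P_E^{3/2}`, `B′ = ∮ v dv/P_E^{3/2}`. -/
theorem elliptic_integral_relations_A2_A3_A4
    (E : ℂ) (γ γ' p : ℝ → ℂ)
    (hγd : ∀ t ∈ Icc (0 : ℝ) 1, HasDerivWithinAt γ (γ' t) (Icc (0 : ℝ) 1) t)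
    (hγ'c : ContinuousOn γ' (Icc (0 : ℝ) 1))
    (hγcl : γ 1 = γ 0)
    (hpc : ContinuousOn p (Icc (0 : ℝ) 1))
    (hp2 : ∀ t ∈ Icc (0 : ℝ) 1,
      p t ^ 2 = γ t ^ 4 + 2 * γ t + 2 * E ∧ γ t ^ 4 + 2 * γ t + 2 * E ≠ 0)
    (hpcl : p 1 = p 0) :
    3 * (∫ t in (0 : ℝ)..1, p t * γ' t)
      = 3 * (∫ t in (0 : ℝ)..1, γ t * γ' t / p t)
        + 4 * E * (∫ t in (0 : ℝ)..1, γ' t / p t) ∧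
    2 * (∫ t in (0 : ℝ)..1, γ t * p t * γ' t)
      = (3 / 2) * (∫ t in (0 : ℝ)..1, γ t ^ 2 * γ' t / p t)
        + 2 * E * (∫ t in (0 : ℝ)..1, γ t * γ' t / p t) ∧
    3 * (∫ t in (0 : ℝ)..1, γ t ^ 2 * γ' t / p t ^ 3)
      = -(4 * E * (∫ t in (0 : ℝ)..1, γ t * γ' t / p t ^ 3)) := by
  have hp0 : ∀ t ∈ Icc (0 : ℝ) 1, p t ≠ 0 := by
    intro t ht h
    apply (hp2 t ht).2
    rw [← (hp2 t ht).1, h]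
    ring
  have hγc : ContinuousOn γ (Icc (0 : ℝ) 1) := fun t ht => (hγd t ht).continuousWithinAt
  have hpd : ∀ t ∈ Icc (0 : ℝ) 1,
      HasDerivWithinAt p ((2 * γ t ^ 3 + 1) * γ' t / p t) (Icc (0 : ℝ) 1) t := by
    intro t ht
    have hP := (((hγd t ht).pow 4).add ((hγd t ht).const_mul 2)).add_const (2 * E)
    refine (HasDerivWithinAt.of_sq hP (hpc t ht) ht (fun x hx => (hp2 x hx).1)
      (hp0 t ht)).congr_deriv ?_
    have := hp0 t ht
    field_simp
    push_cast
    ring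
  have hp3 : ∀ t ∈ Icc (0 : ℝ) 1, p t ^ 3 ≠ 0 := fun t ht => pow_ne_zero 3 (hp0 t ht)
  have hint : ∀ {f : ℝ → ℂ}, ContinuousOn f (Icc (0 : ℝ) 1) →
      IntervalIntegrable f MeasureTheory.volume 0 1 :=
    fun hf => hf.intervalIntegrable_of_Icc zero_le_one
  have cω' : ContinuousOn (fun t => p t * γ' t) (Icc (0 : ℝ) 1) := hpc.mul hγ'c
  have cω : ContinuousOn (fun t => γ' t / p t) (Icc (0 : ℝ) 1) := hγ'c.div hpc hp0
  have cφ : ContinuousOn (fun t => γ t * γ' t / p t) (Icc (0 : ℝ) 1) :=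
    (hγc.mul hγ'c).div hpc hp0
  have cφ' : ContinuousOn (fun t => γ t * p t * γ' t) (Icc (0 : ℝ) 1) :=
    (hγc.mul hpc).mul hγ'c
  have cψ : ContinuousOn (fun t => γ t ^ 2 * γ' t / p t) (Icc (0 : ℝ) 1) :=
    ((hγc.pow 2).mul hγ'c).div hpc hp0
  have cA : ContinuousOn (fun t => γ t ^ 2 * γ' t / p t ^ 3) (Icc (0 : ℝ) 1) :=
    ((hγc.pow 2).mul hγ'c).div (hpc.pow 3) hp3
  have cB : ContinuousOn (fun t => γ t * γ' t / p t ^ 3) (Icc (0 : ℝ) 1) :=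
    (hγc.mul hγ'c).div (hpc.pow 3) hp3
  refine ⟨?_, ?_, ?_⟩
  · have h := intervalIntegral_eq_zero_of_hasDerivWithinAt (F := fun t => γ t * p t)
      (F' := fun t => 3 * (p t * γ' t) - 3 * (γ t * γ' t / p t) - 4 * E * (γ' t / p t))
      zero_le_one
      (fun t ht => ((hγd t ht).mul (hpd t ht)).congr_deriv (by
        have := hp0 t ht
        field_simp
        linear_combination (-2 * γ' t) * (hp2 t ht).1))
      (((cω'.const_mul 3).sub (cφ.const_mul 3)).sub (cω.const_mul (4 * E)))
      (by simp only [hγcl, hpcl])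
    rw [intervalIntegral.integral_sub
        (((hint cω').const_mul 3).sub ((hint cφ).const_mul 3)) ((hint cω).const_mul (4 * E)),
      intervalIntegral.integral_sub ((hint cω').const_mul 3) ((hint cφ).const_mul 3)] at h
    simp only [intervalIntegral.integral_const_mul] at h
    linear_combination h
  · have h := intervalIntegral_eq_zero_of_hasDerivWithinAt (F := fun t => γ t ^ 2 * p t)
      (F' := fun t => 4 * (γ t * p t * γ' t) - 3 * (γ t ^ 2 * γ' t / p t)
        - 4 * E * (γ t * γ' t / p t))
      zero_le_one
      (fun t ht => (((hγd t ht).pow 2).mul (hpd t ht)).congr_deriv (by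
        have := hp0 t ht
        simp only [Pi.pow_apply]
        field_simp
        push_cast
        linear_combination (-2 * γ t * γ' t) * (hp2 t ht).1))
      (((cφ'.const_mul 4).sub (cψ.const_mul 3)).sub (cφ.const_mul (4 * E)))
      (by simp only [hγcl, hpcl])
    rw [intervalIntegral.integral_sub
        (((hint cφ').const_mul 4).sub ((hint cψ).const_mul 3)) ((hint cφ).const_mul (4 * E)),
      intervalIntegral.integral_sub ((hint cφ').const_mul 4) ((hint cψ).const_mul 3)] at h
    simp only [intervalIntegral.integral_const_mul] at h
    linear_combination h / 2
  · have h := intervalIntegral_eq_zero_of_hasDerivWithinAt (F := fun t => γ t ^ 2 / p t)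
      (F' := fun t => 3 * (γ t ^ 2 * γ' t / p t ^ 3) + 4 * E * (γ t * γ' t / p t ^ 3))
      zero_le_one
      (fun t ht => (((hγd t ht).pow 2).div (hpd t ht) (hp0 t ht)).congr_deriv (by
        have := hp0 t ht
        simp only [Pi.pow_apply]
        field_simp
        push_cast
        linear_combination (2 * γ t * γ' t) * (hp2 t ht).1))
      ((cA.const_mul 3).add (cB.const_mul (4 * E)))
      (by simp only [hγcl, hpcl])
    rw [intervalIntegral.integral_add ((hint cA).const_mul 3)
      ((hint cB).const_mul (4 * E))] at h
    simp only [intervalIntegral.integral_const_mul] at h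
    linear_combination h
end

section
/- Let E ∈ ℂ, let γ : [0,1] → ℂ be a C¹ path with γ(1) = γ(0), and let p : [0,1] → ℂ be continuous with p(t)² = γ(t)⁴ + 2·γ(t) + 2E ≠ 0 for all t and p(1) = p(0). Define ω := ∫₀¹ γ′/p dt, ψ := ∫₀¹ γ²·γ′/p dt, C := ∫₀¹ γ′/p³ dt, A := ∫₀¹ γ²·γ′/p³ dt and Bʹ := ∫₀¹ γ·γ′/p³ dt. Then: (i) 3·C = 2·ψ + 8·E·A; and (ii) ω = 3·Bʹ + 4·E·C. -/
open Set

/-- A continuous branch of the square root of a differentiable function is differentiable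
wherever it does not vanish. -/
theorem HasDerivWithinAt.of_sq_eq {p Q : ℝ → ℂ} {Q' : ℂ} {s : Set ℝ} {t : ℝ}
    (hQ : HasDerivWithinAt Q Q' s t) (hp : ContinuousWithinAt p s t)
    (hsq : ∀ x ∈ s, p x ^ 2 = Q x) (ht : t ∈ s) (h0 : p t ≠ 0) :
    HasDerivWithinAt p (Q' / (2 * p t)) s t := by
  rw [hasDerivWithinAt_iff_tendsto_slope] at hQ ⊢
  have hp' : Filter.Tendsto p (nhdsWithin t (s \ {t})) (nhds (p t)) := hp.mono sdiff_subset
  have hsum := hp'.add_const (p t)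
  rw [← two_mul] at hsum
  have h2 : 2 * p t ≠ 0 := mul_ne_zero two_ne_zero h0
  refine (hQ.div hsum h2).congr' ?_
  filter_upwards [hsum.eventually_ne h2, self_mem_nhdsWithin] with x hx hxs
  rw [Pi.div_apply, div_eq_iff hx, slope_def_module, slope_def_module, ← hsq x hxs.1, ← hsq t ht,
    smul_mul_assoc]
  ring_nf

/-- The integral of the exact form `d(q(v) / √P)`, for `P = v⁴ + 2v + 2E`, over a closed loop
on the Riemann surface of `√P` vanishes. -/
theorem integral_exact_form_eq_zero {E : ℂ} {γ γ' p : ℝ → ℂ} {q q' : ℂ → ℂ}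
    (hq : ∀ v, HasDerivAt q (q' v) v) (hq'c : Continuous q')
    (hγd : ∀ t ∈ Icc (0 : ℝ) 1, HasDerivWithinAt γ (γ' t) (Icc (0 : ℝ) 1) t)
    (hγ'c : ContinuousOn γ' (Icc (0 : ℝ) 1)) (hγcl : γ 1 = γ 0)
    (hpc : ContinuousOn p (Icc (0 : ℝ) 1))
    (hp2 : ∀ t ∈ Icc (0 : ℝ) 1, p t ^ 2 = γ t ^ 4 + 2 * γ t + 2 * E)
    (hp0 : ∀ t ∈ Icc (0 : ℝ) 1, p t ≠ 0) (hpcl : p 1 = p 0) :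
    ∫ t in (0 : ℝ)..1,
      (q' (γ t) * p t ^ 2 - q (γ t) * (2 * γ t ^ 3 + 1)) * γ' t / p t ^ 3 = 0 := by
  have hγc : ContinuousOn γ (Icc (0 : ℝ) 1) := fun t ht ↦ (hγd t ht).continuousWithinAt
  have hqc : Continuous q := continuous_iff_continuousAt.2 fun v ↦ (hq v).continuousAt
  have hqγ : ContinuousOn (fun t ↦ q (γ t)) (Icc (0 : ℝ) 1) := hqc.comp_continuousOn hγc
  have hq'γ : ContinuousOn (fun t ↦ q' (γ t)) (Icc (0 : ℝ) 1) := hq'c.comp_continuousOn hγc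
  rw [intervalIntegral.integral_eq_sub_of_hasDerivAt_of_le (f := fun t ↦ q (γ t) / p t)
    zero_le_one (hqγ.div hpc hp0)]
  · simp [hγcl, hpcl]
  · intro t ht
    have htI := Ioo_subset_Icc_self ht
    have hγt := hγd t htI
    have hP : HasDerivWithinAt (fun s ↦ γ s ^ 4 + 2 * γ s + 2 * E)
        (4 * γ t ^ 3 * γ' t + 2 * γ' t) (Icc (0 : ℝ) 1) t := by
      simpa using ((hγt.pow 4).add (hγt.const_mul 2)).add_const (2 * E)
    have hpt := hP.of_sq_eq (hpc t htI) hp2 htI (hp0 t htI)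
    have hqt := (hq (γ t)).comp_hasDerivWithinAt t hγt
    refine ((hqt.div hpt (hp0 t htI)).hasDerivAt (Icc_mem_nhds ht.1 ht.2)).congr_deriv ?_
    have := hp0 t htI
    simp only [Function.comp_apply]
    field_simp
    ring
  · refine ContinuousOn.intervalIntegrable_of_Icc zero_le_one (ContinuousOn.div ?_ (hpc.pow 3)
      fun t ht ↦ pow_ne_zero 3 (hp0 t ht))
    fun_prop

/-- Relations (A.1′) and (A.2′) between complete elliptic
integrals over a closed loop on the Riemann surface of `√(v⁴ + 2v + 2E)`:
(i) `3C = 2ψ + 8EA`; (ii) `ω = 3B′ + 4EC`, where `ω = ∮ dv/√P_E`,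
`ψ = ∮ v² dv/√P_E`, `C = ∮ dv/P_E^{3/2}`, `A = ∮ v² dv/P_E^{3/2}`,
`B′ = ∮ v dv/P_E^{3/2}`. -/
theorem elliptic_integral_relations_A1p_A2p
    (E : ℂ) (γ γ' p : ℝ → ℂ)
    (hγd : ∀ t ∈ Icc (0 : ℝ) 1, HasDerivWithinAt γ (γ' t) (Icc (0 : ℝ) 1) t)
    (hγ'c : ContinuousOn γ' (Icc (0 : ℝ) 1))
    (hγcl : γ 1 = γ 0)
    (hpc : ContinuousOn p (Icc (0 : ℝ) 1))
    (hp2 : ∀ t ∈ Icc (0 : ℝ) 1,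
      p t ^ 2 = γ t ^ 4 + 2 * γ t + 2 * E ∧ γ t ^ 4 + 2 * γ t + 2 * E ≠ 0)
    (hpcl : p 1 = p 0) :
    3 * (∫ t in (0 : ℝ)..1, γ' t / p t ^ 3)
      = 2 * (∫ t in (0 : ℝ)..1, γ t ^ 2 * γ' t / p t)
        + 8 * E * (∫ t in (0 : ℝ)..1, γ t ^ 2 * γ' t / p t ^ 3) ∧
    (∫ t in (0 : ℝ)..1, γ' t / p t)
      = 3 * (∫ t in (0 : ℝ)..1, γ t * γ' t / p t ^ 3)
        + 4 * E * (∫ t in (0 : ℝ)..1, γ' t / p t ^ 3) := by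
  have hp0 : ∀ t ∈ Icc (0 : ℝ) 1, p t ≠ 0 := fun t ht h ↦
    (hp2 t ht).2 (by rw [← (hp2 t ht).1, h]; ring)
  have hp2' := fun t ht ↦ (hp2 t ht).1
  have hγc : ContinuousOn γ (Icc (0 : ℝ) 1) := fun t ht ↦ (hγd t ht).continuousWithinAt
  have hint : ∀ (m n : ℕ), IntervalIntegrable (fun t ↦ γ t ^ m * γ' t / p t ^ n)
      MeasureTheory.volume 0 1 := fun m n ↦
    (((hγc.pow m).mul hγ'c).div (hpc.pow n)
      fun t ht ↦ pow_ne_zero n (hp0 t ht)).intervalIntegrable_of_Icc zero_le_one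
  have hC := hint 0 3
  have hA := hint 2 3
  have hB := hint 1 3
  have hψ := hint 2 1
  have hω := hint 0 1
  simp only [pow_zero, pow_one, one_mul] at hC hA hB hψ hω
  constructor
  · have hq : ∀ v : ℂ, HasDerivAt (fun v : ℂ ↦ -2 * v ^ 3 - 3) (-6 * v ^ 2) v := fun v ↦
      (((hasDerivAt_pow 3 v).const_mul (-2)).sub_const 3).congr_deriv (by norm_num; ring)
    have hexact := integral_exact_form_eq_zero hq (by fun_prop) hγd hγ'c hγcl hpc hp2' hp0 hpcl
    rw [← sub_eq_zero, ← hexact, ← intervalIntegral.integral_const_mul,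
      ← intervalIntegral.integral_const_mul, ← intervalIntegral.integral_const_mul,
      ← intervalIntegral.integral_add (hψ.const_mul _) (hA.const_mul _),
      ← intervalIntegral.integral_sub (hC.const_mul _)
        ((hψ.const_mul _).add (hA.const_mul _))]
    refine intervalIntegral.integral_congr fun t ht ↦ ?_
    rw [uIcc_of_le zero_le_one] at ht
    have := hp0 t ht
    field_simp
    rw [hp2' t ht]
    ring
  · have hq : ∀ v : ℂ, HasDerivAt (fun v : ℂ ↦ -v) (-1) v := fun v ↦ hasDerivAt_neg v
    have hexact := integral_exact_form_eq_zero hq (by fun_prop) hγd hγ'c hγcl hpc hp2' hp0 hpcl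
    rw [← sub_eq_zero, ← hexact, ← intervalIntegral.integral_const_mul,
      ← intervalIntegral.integral_const_mul,
      ← intervalIntegral.integral_add (hB.const_mul _) (hC.const_mul _),
      ← intervalIntegral.integral_sub hω ((hB.const_mul _).add (hC.const_mul _))]
    refine intervalIntegral.integral_congr fun t ht ↦ ?_
    rw [uIcc_of_le zero_le_one] at ht
    have := hp0 t ht
    field_simp
    rw [hp2' t ht]
    ring
end

section
/- Let U ⊆ ℂ be open, let γ : [0,1] → ℂ be a C¹ path with γ(1) = γ(0), and let p : U × [0,1] → ℂ be continuous with p(E,t)² = γ(t)⁴ + 2·γ(t) + 2E ≠ 0 for all (E,t) ∈ U × [0,1] and p(E,1) = p(E,0) for all E ∈ U. Define ψ̃(E) := ∫₀¹ γ(t)²·p(E,t)·γ′(t) dt and ψ(E) := ∫₀¹ γ(t)²·γ′(t)/p(E,t) dt. Then: (i) ψ̃ is differentiable on U with ψ̃′(E) = ψ(E); (ii) ψ is differentiable on U with ψ′(E) = −∫₀¹ γ(t)²·γ′(t)/p(E,t)³ dt; and (iii) for every E ∈ U with 128·E³ ≠ 27, ψ̃ is twice differentiable at E and ψ̃″(E)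 = (40·E/(128·E³ − 27))·ψ̃(E). -/
open Set Filter Topology MeasureTheory

/-- A continuous square root of a differentiable function is differentiable wherever it does not
vanish. -/
theorem HasDerivAt.of_sq {𝕜 L : Type*} [NontriviallyNormedField 𝕜] [NormedField L]
    [NormedAlgebra 𝕜 L] [CharZero L] {f g : 𝕜 → L} {g' : L} {x : 𝕜} (hf : ContinuousAt f x)
    (hfg : ∀ᶠ y in 𝓝 x, f y ^ 2 = g y) (hg : HasDerivAt g g' x) (hx : f x ≠ 0) :
    HasDerivAt f (g' / (2 * f x)) x := by
  have hsum : Tendsto (fun y => f y + f x) (𝓝 x) (𝓝 (2 * f x)) := by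
    simpa [two_mul] using hf.tendsto.add_const (f x)
  have h2 : 2 * f x ≠ 0 := mul_ne_zero two_ne_zero hx
  rw [hasDerivAt_iff_tendsto_slope] at hg ⊢
  refine (hg.div (hsum.mono_left nhdsWithin_le_nhds) h2).congr' ?_
  filter_upwards [(hfg.and (hsum.eventually_ne h2)).filter_mono nhdsWithin_le_nhds]
    with y ⟨hy, hne⟩
  rw [Pi.div_apply, slope_def_module, slope_def_module, ← hy, ← hfg.self_of_nhds,
    sq_sub_sq, mul_comm (f y + f x), ← smul_mul_assoc, mul_div_cancel_right₀ _ hne]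

/-- Differentiation under an integral over a compact interval, when the derivative of the
integrand is jointly continuous. -/
theorem hasDerivAt_intervalIntegral_of_continuousOn {U : Set ℂ} (hU : IsOpen U) {a b : ℝ}
    (hab : a ≤ b) {F F' : ℂ → ℝ → ℂ} (hF : ∀ z ∈ U, ContinuousOn (F z) (Icc a b))
    (hF' : ContinuousOn (fun q : ℂ × ℝ => F' q.1 q.2) (U ×ˢ Icc a b))
    (hd : ∀ z ∈ U, ∀ t ∈ Icc a b, HasDerivAt (fun w => F w t) (F' z t) z) {z : ℂ} (hz : z ∈ U) :
    HasDerivAt (fun w => ∫ t in a..b, F w t) (∫ t in a..b, F' z t) z := by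
  obtain ⟨r, hr, hrU⟩ := Metric.nhds_basis_closedBall.mem_iff.1 (hU.mem_nhds hz)
  obtain ⟨C, hC⟩ := ((isCompact_closedBall z r).prod isCompact_Icc).exists_bound_of_continuousOn
    (hF'.mono (Set.prod_mono_left hrU))
  have hsub : uIoc a b ⊆ Icc a b := by rw [uIoc_of_le hab]; exact Ioc_subset_Icc_self
  have hF'z : ContinuousOn (F' z) (Icc a b) :=
    hF'.comp (by fun_prop) fun t ht => (⟨hz, ht⟩ : (z, t) ∈ U ×ˢ Icc a b)
  refine (intervalIntegral.hasDerivAt_integral_of_dominated_loc_of_deriv_le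
    (bound := fun _ => C) (Metric.closedBall_mem_nhds z hr) ?_ ?_ ?_ ?_ ?_ ?_).2
  · filter_upwards [hU.mem_nhds hz] with w hw
    exact ((hF w hw).mono hsub).aestronglyMeasurable measurableSet_uIoc
  · exact (hF z hz).intervalIntegrable_of_Icc hab
  · exact (hF'z.mono hsub).aestronglyMeasurable measurableSet_uIoc
  · exact .of_forall fun t ht w hw => hC (w, t) ⟨hw, hsub ht⟩
  · exact intervalIntegrable_const
  · exact .of_forall fun t ht w hw => hd w (hrU hw) t (hsub ht)

/-- Lemma A.1 (Picard–Fuchs equation for the periods): with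
`ψ̃(E) = ∮ v²√P_E dv` and `ψ(E) = ∮ v² dv/√P_E` over a closed loop on the
Riemann surface of `√P_E` depending continuously on `E ∈ U`:
(i) `dψ̃/dE = ψ`; (ii) `dψ/dE = −∮ v² dv/P_E^{3/2}`; and (iii) wherever
`128E³ ≠ 27`, `ψ̃` is twice differentiable and
`d²ψ̃/dE² = (40E/(128E³ − 27))·ψ̃`. -/
theorem elliptic_integral_picard_fuchs
    (U : Set ℂ) (hU : IsOpen U)
    (γ γ' : ℝ → ℂ)
    (hγd : ∀ t ∈ Icc (0 : ℝ) 1, HasDerivWithinAt γ (γ' t) (Icc (0 : ℝ) 1) t)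
    (hγ'c : ContinuousOn γ' (Icc (0 : ℝ) 1))
    (hγcl : γ 1 = γ 0)
    (p : ℂ → ℝ → ℂ)
    (hpc : ContinuousOn (fun q : ℂ × ℝ => p q.1 q.2) (U ×ˢ Icc (0 : ℝ) 1))
    (hp2 : ∀ E ∈ U, ∀ t ∈ Icc (0 : ℝ) 1,
      p E t ^ 2 = γ t ^ 4 + 2 * γ t + 2 * E ∧ γ t ^ 4 + 2 * γ t + 2 * E ≠ 0)
    (hpcl : ∀ E ∈ U, p E 1 = p E 0)
    (ψt ψ : ℂ → ℂ)
    (hψt : ∀ E : ℂ, ψt E = ∫ t in (0 : ℝ)..1, γ t ^ 2 * p E t * γ' t)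
    (hψ : ∀ E : ℂ, ψ E = ∫ t in (0 : ℝ)..1, γ t ^ 2 * γ' t / p E t) :
    (∀ E ∈ U, HasDerivAt ψt (ψ E) E) ∧
    (∀ E ∈ U, HasDerivAt ψ
      (-(∫ t in (0 : ℝ)..1, γ t ^ 2 * γ' t / p E t ^ 3)) E) ∧
    (∀ E ∈ U, 128 * E ^ 3 ≠ 27 →
      DifferentiableAt ℂ (deriv ψt) E ∧
      deriv (deriv ψt) E = (40 * E / (128 * E ^ 3 - 27)) * ψt E) := by
  have hp0 : ∀ E ∈ U, ∀ t ∈ Icc (0 : ℝ) 1, p E t ≠ 0 := fun E hE t ht h => by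
    obtain ⟨h1, h2⟩ := hp2 E hE t ht
    exact h2 (by rw [← h1, h]; ring)
  have hγc : ContinuousOn γ (Icc 0 1) := fun t ht => (hγd t ht).continuousWithinAt
  have hγ₂ : ContinuousOn (fun q : ℂ × ℝ => γ q.2) (U ×ˢ Icc (0 : ℝ) 1) :=
    hγc.comp continuousOn_snd fun q hq => hq.2
  have hγ'₂ : ContinuousOn (fun q : ℂ × ℝ => γ' q.2) (U ×ˢ Icc (0 : ℝ) 1) :=
    hγ'c.comp continuousOn_snd fun q hq => hq.2
  have hpt : ∀ E ∈ U, ContinuousOn (p E) (Icc 0 1) := fun E hE =>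
    hpc.comp (by fun_prop) fun t ht => (⟨hE, ht⟩ : (E, t) ∈ U ×ˢ Icc (0 : ℝ) 1)
  have hpE : ∀ E ∈ U, ∀ t ∈ Icc (0 : ℝ) 1, HasDerivAt (fun w => p w t) (1 / p E t) E := by
    intro E hE t ht
    have hc : ContinuousOn (fun w => p w t) U :=
      hpc.comp (f := fun w => (w, t)) (by fun_prop) fun w hw => ⟨hw, ht⟩
    have hg : HasDerivAt (fun w : ℂ => γ t ^ 4 + 2 * γ t + 2 * w) 2 E := by
      simpa using ((hasDerivAt_id E).const_mul 2).const_add (γ t ^ 4 + 2 * γ t)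
    have h0 := hp0 E hE t ht
    refine (HasDerivAt.of_sq (hc.continuousAt (hU.mem_nhds hE))
      (by filter_upwards [hU.mem_nhds hE] with w hw using (hp2 w hw t ht).1)
      hg h0).congr_deriv ?_
    field_simp
  have h1 : ∀ E ∈ U, HasDerivAt ψt (ψ E) E := by
    intro E hE
    rw [funext hψt, hψ]
    refine hasDerivAt_intervalIntegral_of_continuousOn hU zero_le_one
      (F' := fun E t => γ t ^ 2 * γ' t / p E t) (fun w hw => ?_) ?_ (fun w hw t ht => ?_) hE
    · exact ((hγc.pow 2).mul (hpt w hw)).mul hγ'c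
    · exact ((hγ₂.pow 2).mul hγ'₂).div hpc fun q hq => hp0 q.1 hq.1 q.2 hq.2
    · refine (((hpE w hw t ht).const_mul (γ t ^ 2)).mul_const (γ' t)).congr_deriv ?_
      ring
  have h2 : ∀ E ∈ U, HasDerivAt ψ (-(∫ t in (0 : ℝ)..1, γ t ^ 2 * γ' t / p E t ^ 3)) E := by
    intro E hE
    rw [funext hψ, ← intervalIntegral.integral_neg]
    refine hasDerivAt_intervalIntegral_of_continuousOn hU zero_le_one
      (F' := fun E t => -(γ t ^ 2 * γ' t / p E t ^ 3)) (fun w hw => ?_) ?_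
      (fun w hw t ht => ?_) hE
    · exact ((hγc.pow 2).mul hγ'c).div (hpt w hw) (hp0 w hw)
    · exact (((hγ₂.pow 2).mul hγ'₂).div (hpc.pow 3)
        fun q hq => pow_ne_zero 3 (hp0 q.1 hq.1 q.2 hq.2)).neg
    · have h0 := hp0 w hw t ht
      refine ((hasDerivAt_const w (γ t ^ 2 * γ' t)).fun_div (hpE w hw t ht) h0).congr_deriv ?_
      field_simp
      ring
  refine ⟨h1, h2, fun E hE hE27 => ?_⟩
  have hD : (128 * E ^ 3 - 27 : ℂ) ≠ 0 := sub_ne_zero.2 hE27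
  have hderiv : deriv ψt =ᶠ[𝓝 E] ψ := by
    filter_upwards [hU.mem_nhds hE] with w hw using (h1 w hw).deriv
  have h3 := (h2 E hE).congr_of_eventuallyEq hderiv
  refine ⟨h3.differentiableAt, ?_⟩
  rw [h3.deriv, hψt]
  -- A polynomial `Q` for which `d (Q / √P)` realizes the Picard–Fuchs relation.
  set Q : ℂ → ℂ := fun v => -72 * E ^ 2 - 36 * E * v + 9 * v ^ 2 - 48 * E ^ 2 * v ^ 3
    - 28 * E * v ^ 4 - 8 * E * v ^ 7 with hQ
  have hQc : Continuous Q := by fun_prop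
  have hI1 : IntervalIntegrable (fun t => γ t ^ 2 * γ' t / p E t ^ 3) volume 0 1 :=
    (((hγc.pow 2).mul hγ'c).div ((hpt E hE).pow 3)
      fun t ht => pow_ne_zero 3 (hp0 E hE t ht)).intervalIntegrable_of_Icc zero_le_one
  have hI2 : IntervalIntegrable (fun t => γ t ^ 2 * p E t * γ' t) volume 0 1 :=
    (((hγc.pow 2).mul (hpt E hE)).mul hγ'c).intervalIntegrable_of_Icc zero_le_one
  have key : ∫ t in (0 : ℝ)..1, (-(128 * E ^ 3 - 27) * (γ t ^ 2 * γ' t / p E t ^ 3)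
      - 40 * E * (γ t ^ 2 * p E t * γ' t)) = Q (γ 1) / p E 1 - Q (γ 0) / p E 0 := by
    refine intervalIntegral.integral_eq_sub_of_hasDerivAt_of_le zero_le_one
      (f := fun t => Q (γ t) / p E t)
      ((hQc.comp_continuousOn hγc).div (hpt E hE) (hp0 E hE)) (fun t ht => ?_)
      ((hI1.const_mul _).sub (hI2.const_mul _))
    have ht' := Ioo_subset_Icc_self ht
    have hnhds := Icc_mem_nhds ht.1 ht.2
    have h0 := hp0 E hE t ht'
    have hγt := (hγd t ht').hasDerivAt hnhds
    have hPt : HasDerivAt (fun s => γ s ^ 4 + 2 * γ s + 2 * E)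
        ((4 * γ t ^ 3 + 2) * γ' t) t := by
      refine (((hγt.fun_pow 4).fun_add (hγt.const_mul 2)).add_const (2 * E)).congr_deriv ?_
      push_cast
      ring
    have hpd := HasDerivAt.of_sq ((hpt E hE).continuousAt hnhds)
      (by filter_upwards [hnhds] with s hs using (hp2 E hE s hs).1) hPt h0
    have hQd : HasDerivAt Q (-36 * E + 18 * γ t - 144 * E ^ 2 * γ t ^ 2 - 112 * E * γ t ^ 3
        - 56 * E * γ t ^ 6) (γ t) := by
      have hid := hasDerivAt_id' (γ t)
      refine ((((((hid.const_mul (36 * E)).const_sub (-72 * E ^ 2)).fun_add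
        ((hid.fun_pow 2).const_mul 9)).fun_sub ((hid.fun_pow 3).const_mul (48 * E ^ 2))).fun_sub
        ((hid.fun_pow 4).const_mul (28 * E))).fun_sub
        ((hid.fun_pow 7).const_mul (8 * E))).congr_deriv ?_
      push_cast
      ring
    refine ((hQd.comp t hγt).fun_div hpd h0).congr_deriv ?_
    have hsq := (hp2 E hE t ht').1
    have hq4 : p E t ^ 4 = (γ t ^ 4 + 2 * γ t + 2 * E) ^ 2 := by rw [← hsq]; ring
    simp only [Function.comp_apply, hQ]
    field_simp
    linear_combination 80 * E * γ t ^ 2 * γ' t * hq4 + 2 * γ' t * (-36 * E + 18 * γ t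
      - 144 * E ^ 2 * γ t ^ 2 - 112 * E * γ t ^ 3 - 56 * E * γ t ^ 6) * hsq
  rw [hγcl, hpcl E hE, sub_self, intervalIntegral.integral_sub (hI1.const_mul _)
    (hI2.const_mul _), intervalIntegral.integral_const_mul, intervalIntegral.integral_const_mul]
    at key
  rw [div_mul_eq_mul_div, eq_div_iff hD]
  linear_combination key
end
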